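/- Let T be a nonempty basic tile and T' a non-basic Morse tile, on disjoint vertex sets. Then sd(T * T') carries a Morse shelling which begins with the derived neighborhood N(T, T * T') and which uses a critical tile if and only if T * T' is critical. Moreover, when T * T' is critical, the critical tile of the tiling is unique, isomorphic to T * T', and disjoint from N(T, T * T'). -/

import Mathlib

/-!
Common combinatorial framework for Morse shellings of simplicial complexes,
following J.-Y. Welschinger, "Morse shellings out of discrete Morse functions".
-/

namespace MorseShelling

variable {V : Type*} [DecidableEq V] {W : Type*} [DecidableEq W]

/-- A (finite, combinatorial) simplicial complex: a downward-closed collection of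
finite subsets (simplices) of the vertex type. -/
def IsComplex (K : Finset (Finset V)) : Prop :=
  ∀ σ ∈ K, ∀ τ ⊆ σ, τ ∈ K

/-- A relative simplicial complex `S = K \ L`, recorded as the pair `(K, L)`. -/
structure RelCplx (V : Type*) where
  K : Finset (Finset V)
  L : Finset (Finset V)

/-- The faces of a relative simplicial complex. -/
def RelCplx.faces (S : RelCplx V) : Finset (Finset V) := S.K \ S.L

/-- Validity of a relative simplicial complex: both members are complexes and
`L` is a subcomplex of `K`. -/
def RelCplx.IsValid (S : RelCplx V) : Prop :=
  IsComplex S.K ∧ IsComplex S.L ∧ S.L ⊆ S.K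

/-- Join of two collections of faces (on disjoint vertex supports). -/
def joinF (K₁ K₂ : Finset (Finset V)) : Finset (Finset V) :=
  (K₁ ×ˢ K₂).image fun p => p.1 ∪ p.2

/-- Join of two relative simplicial complexes:
`(K₁ * K₂) \ ((L₁ * K₂) ∪ (K₁ * L₂))`. -/
def RelCplx.join (S₁ S₂ : RelCplx V) : RelCplx V :=
  ⟨joinF S₁.K S₂.K, joinF S₁.L S₂.K ∪ joinF S₁.K S₂.L⟩

/-- The star of a simplex `σ` in `K` : all faces `τ` with `σ ∪ τ ∈ K`. -/
def star (K : Finset (Finset V)) (σ : Finset V) : Finset (Finset V) :=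
  K.filter fun τ => σ ∪ τ ∈ K

/-- The link of a simplex `σ` in `K` : all faces `τ` of the star disjoint from `σ`. -/
def link (K : Finset (Finset V)) (σ : Finset V) : Finset (Finset V) :=
  K.filter fun τ => σ ∪ τ ∈ K ∧ σ ∩ τ = ∅

/-- The star of a simplex in a relative complex, `st_S(σ) = st_K(σ) \ st_L(σ)`. -/
def RelCplx.starR (S : RelCplx V) (σ : Finset V) : RelCplx V :=
  ⟨star S.K σ, star S.L σ⟩

/-- The link of a simplex in a relative complex, `lk_S(σ) = lk_K(σ) \ lk_L(σ)`. -/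
def RelCplx.linkR (S : RelCplx V) (σ : Finset V) : RelCplx V :=
  ⟨link S.K σ, link S.L σ⟩

/-- The boundary complex of a simplex: all its proper faces (including `∅`). -/
def boundary (σ : Finset V) : Finset (Finset V) := σ.powerset.erase σ

/-- First barycentric subdivision: the faces are the (possibly empty) flags
`∅ ≠ σ₀ ⊊ σ₁ ⊊ ... ⊊ σ_q` of nonempty faces of `K`, a nonempty face `σ` of `K`
becoming the vertex `σ̂ = σ`. By convention `sd ∅ = ∅`. -/
def sd (K : Finset (Finset V)) : Finset (Finset (Finset V)) :=
  if K = ∅ then ∅ else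
    (K.erase ∅).powerset.filter fun c => ∀ a ∈ c, ∀ b ∈ c, a ⊆ b ∨ b ⊆ a

/-- First barycentric subdivision of a relative complex: `sd (K \ L) = sd K \ sd L`. -/
def RelCplx.sdR (S : RelCplx V) : RelCplx (Finset V) := ⟨sd S.K, sd S.L⟩

/-- An (absolute) simplicial complex seen as a relative one. -/
def toRel (K : Finset (Finset V)) : RelCplx V := ⟨K, ∅⟩

/-- The vertex support of a relative complex. -/
def suppK (S : RelCplx V) : Finset V := S.K.sup id

/-- The ridges (codimension one faces) of a simplex. -/
def ridges (σ : Finset V) : Finset (Finset V) := σ.image fun v => σ.erase v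

/-- The subcomplex of the simplex `σ` consisting of the faces contained in some
member of `R`. -/
def below (σ : Finset V) (R : Finset (Finset V)) : Finset (Finset V) :=
  σ.powerset.filter fun τ => ∃ ρ ∈ R, τ ⊆ ρ

/-- The restriction set of the basic tile `σ \ R`: the face spanned by the
vertices opposite to the missing ridges `R`. -/
def restSet (σ : Finset V) (R : Finset (Finset V)) : Finset V :=
  σ.filter fun v => σ.erase v ∈ R

/-- A basic tile of dimension `n` and order `k`: an `n`-simplex deprived of `k`
of its ridges (together with all the faces contained in them). -/
def IsBasicTile (S : RelCplx V) (n k : ℕ) : Prop :=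
  ∃ σ : Finset V, σ.card = n + 1 ∧ S.K = σ.powerset ∧
    ∃ R ⊆ ridges σ, R.card = k ∧ S.L = below σ R

/-- A Morse tile of dimension `n` and order `k`: a basic tile, possibly further
deprived of a unique face of higher codimension (its Morse face). -/
def IsMorseTile (S : RelCplx V) (n k : ℕ) : Prop :=
  ∃ σ : Finset V, σ.card = n + 1 ∧ S.K = σ.powerset ∧
    ∃ R ⊆ ridges σ, R.card = k ∧
      (S.L = below σ R ∨
        ∃ μ ⊆ σ, μ ∉ below σ R ∧ μ.card + 2 ≤ σ.card ∧
          S.L = below σ R ∪ below σ {μ})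

/-- A critical tile of dimension `n` and index `k`: either a closed simplex
(index `0`), or a basic tile of order `k` deprived of its restriction set
(this includes the dotted simplex for `k = 0` and the open simplex for `k = n`). -/
def IsCriticalTile (S : RelCplx V) (n k : ℕ) : Prop :=
  ∃ σ : Finset V, σ.card = n + 1 ∧ S.K = σ.powerset ∧
    ((k = 0 ∧ S.L = ∅) ∨
      (k ≤ n ∧ ∃ R ⊆ ridges σ, R.card = k ∧
        S.L = below σ R ∪ below σ {restSet σ R}))

/-- A closed simplex, as a tile. -/
def IsClosedSimplexTile (S : RelCplx V) : Prop :=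
  ∃ σ : Finset V, S.K = σ.powerset ∧ S.L = ∅

/-- An open simplex, as a tile: deprived of its whole boundary, incl. the empty face. -/
def IsOpenSimplexTile (S : RelCplx V) : Prop :=
  ∃ σ : Finset V, σ ≠ ∅ ∧ S.K = σ.powerset ∧ S.L = σ.powerset.erase σ

/-- The closed simplex on vertex set `σ`, as a relative complex. -/
def closedT (σ : Finset V) : RelCplx V := ⟨σ.powerset, ∅⟩

/-- The open simplex on vertex set `σ`. -/
def openT (σ : Finset V) : RelCplx V := ⟨σ.powerset, σ.powerset.erase σ⟩

/-- The closed simplex deprived of its empty face, `σ̇` (the neutral tile when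
`σ = ∅`, so that empty factors may be dropped from joins). -/
def dotT (σ : Finset V) : RelCplx V := ⟨σ.powerset, if σ = ∅ then ∅ else {∅}⟩

/-- The Morse tile `σ * θ̊ * τ̇`. -/
def splitTile (σ θ τ : Finset V) : RelCplx V :=
  (closedT σ).join ((openT θ).join (dotT τ))

/-- A tiling of a relative simplicial complex by `N` relative facets: the tiles
are relative simplices whose underlying simplices are facets, and their faces
partition the faces of `S`. -/
structure Tiling (S : RelCplx W) (N : ℕ) where
  tile : Fin N → RelCplx W
  isFacet : ∀ i, ∃ σ ∈ S.K, (∀ τ ∈ S.K, σ ⊆ τ → τ = σ) ∧ (tile i).K = σ.powerset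
  subL : ∀ i, (tile i).L ⊆ (tile i).K
  disj : ∀ i j, i ≠ j → Disjoint (tile i).faces (tile j).faces
  cover : (Finset.univ : Finset (Fin N)).biUnion (fun i => (tile i).faces) = S.faces

/-- The union of the faces of the first `p` tiles of a tiling. -/
def Tiling.prefixFaces {S : RelCplx W} {N : ℕ} (T : Tiling S N) (p : ℕ) :
    Finset (Finset W) :=
  (Finset.univ.filter fun i : Fin N => (i : ℕ) < p).biUnion fun i => (T.tile i).faces

/-- A tiling is a shelling when each of the sets of faces of `S_p = K_p \ L`
is a relative subcomplex, i.e. `L ∪ (tiles of index < p)` is a complex. -/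
def Tiling.IsShelling {S : RelCplx W} {N : ℕ} (T : Tiling S N) : Prop :=
  ∀ p ≤ N, IsComplex (S.L ∪ T.prefixFaces p)

/-- A (shelled) tiling begins with a set `F` of faces when some initial segment
of its tiles partitions exactly `F`. -/
def Tiling.BeginsWith {S : RelCplx W} {N : ℕ} (T : Tiling S N)
    (F : Finset (Finset W)) : Prop :=
  ∃ p ≤ N, T.prefixFaces p = F

/-- A Morse tiling: all tiles are Morse tiles. -/
def Tiling.IsMorse {S : RelCplx W} {N : ℕ} (T : Tiling S N) : Prop :=
  ∀ i, ∃ n k, IsMorseTile (T.tile i) n k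

/-- An h-tiling: all tiles are basic or critical tiles. -/
def Tiling.IsH {S : RelCplx W} {N : ℕ} (T : Tiling S N) : Prop :=
  ∀ i, (∃ n k, IsBasicTile (T.tile i) n k) ∨ (∃ n k, IsCriticalTile (T.tile i) n k)

/-- `f` induces a simplicial isomorphism from `A` onto `B` (both viewed through
their collections of faces). -/
def IsSimplicialIso (f : V → W) (A : Finset (Finset V)) (B : Finset (Finset W)) : Prop :=
  Set.BijOn (fun σ : Finset V => σ.image f) ↑A ↑B

/-- `f` induces an isomorphism of relative simplicial complexes. -/
def IsRelIso (f : V → W) (S : RelCplx V) (S' : RelCplx W) : Prop :=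
  Set.BijOn (fun σ : Finset V => σ.image f) ↑S.K ↑S'.K ∧
    Set.BijOn (fun σ : Finset V => σ.image f) ↑S.L ↑S'.L

/-- The first derived neighborhood `N(L, K)` of a subcomplex `L` in `K` : the union
of the stars in `sd K` of the vertices of `L`. -/
def derivedNbhd (L K : Finset (Finset V)) : Finset (Finset (Finset V)) :=
  (L.filter fun s => s.card = 1).biUnion fun s => star (sd K) {s}

/-- The faces of the derived neighborhood `N(T, S)` of a tile `T` in a relative
complex `S`: the union of the relative stars in `sd S` of the vertices of `T`. -/
def relDerivedNbhd (T S : RelCplx V) : Finset (Finset (Finset V)) :=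
  ((suppK T).biUnion fun v => ((S.sdR).starR {({v} : Finset V)}).faces) ∩ (S.sdR).faces

/-- A discrete Morse function on the finite simplicial complex `K`. -/
def IsDiscreteMorse (K : Finset (Finset V)) (f : Finset V → ℝ) : Prop :=
  ∀ σ ∈ K, σ ≠ ∅ →
    (K.filter fun τ => σ ⊂ τ ∧ f τ ≤ f σ).card ≤ 1 ∧
    (K.filter fun θ => θ ≠ ∅ ∧ θ ⊂ σ ∧ f σ ≤ f θ).card ≤ 1

/-- A critical face of a discrete Morse function. -/
def IsCriticalFace (K : Finset (Finset V)) (f : Finset V → ℝ) (σ : Finset V) : Prop :=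
  σ ∈ K ∧ σ ≠ ∅ ∧ (∀ τ ∈ K, σ ⊂ τ → f σ < f τ) ∧
    ∀ θ ∈ K, θ ≠ ∅ → θ ⊂ σ → f θ < f σ

/-- An elementary collapse: removal of a facet `τ` together with a ridge `θ` of it
contained in no other facet. -/
def ElementaryCollapse (K K' : Finset (Finset V)) : Prop :=
  ∃ τ ∈ K, ∃ θ ∈ K, θ ⊆ τ ∧ τ.card = θ.card + 1 ∧
    (∀ ρ ∈ K, τ ⊆ ρ → ρ = τ) ∧
    (∀ ρ ∈ K, θ ⊆ ρ → ρ = θ ∨ ρ = τ) ∧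
    K' = (K.erase τ).erase θ

/-- A finite simplicial complex is collapsible when some finite sequence of
elementary collapses reduces it to a single vertex. -/
def Collapsible (K : Finset (Finset V)) : Prop :=
  ∃ v : V, Relation.ReflTransGen ElementaryCollapse K {∅, {v}}

/-! ### Maximal flags of a simplex -/

section Flags

variable {σ : Finset V} {M : ℕ}

/-- The set of the first `i + 1` vertices in the enumeration `e` of `σ`. -/
def lev (e : Fin (M + 1) ≃ σ) (i : Fin (M + 1)) : Finset V :=
  (Finset.Iic i).image fun j => (e j : V)

/-- The maximal flag of `σ` associated with the enumeration `e`. -/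
def flag (e : Fin (M + 1) ≃ σ) : Finset (Finset V) := Finset.univ.image (lev e)

theorem mem_lev_iff {e : Fin (M + 1) ≃ σ} {i : Fin (M + 1)} {v : V} :
    v ∈ lev e i ↔ ∃ j ≤ i, (e j : V) = v := by
  simp [lev]

@[simp]
theorem apply_mem_lev {e : Fin (M + 1) ≃ σ} {i j : Fin (M + 1)} :
    (e j : V) ∈ lev e i ↔ j ≤ i := by
  rw [mem_lev_iff]
  constructor
  · rintro ⟨k, hk, h⟩
    rwa [← e.injective (Subtype.ext h)]
  · exact fun h => ⟨j, h, rfl⟩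

theorem exists_apply_eq {U : Type*} {τ : Finset U} (e : Fin (M + 1) ≃ τ) {v : U} (hv : v ∈ τ) :
    ∃ j, (e j : U) = v :=
  ⟨e.symm ⟨v, hv⟩, by simp⟩

theorem lev_subset (e : Fin (M + 1) ≃ σ) (i : Fin (M + 1)) : lev e i ⊆ σ := by
  intro v hv
  obtain ⟨j, -, rfl⟩ := mem_lev_iff.1 hv
  exact (e j).2

theorem lev_subset_lev_iff {e : Fin (M + 1) ≃ σ} {i j : Fin (M + 1)} :
    lev e i ⊆ lev e j ↔ i ≤ j := by
  constructor
  · intro h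
    exact apply_mem_lev.1 (h (apply_mem_lev.2 le_rfl))
  · intro h v hv
    obtain ⟨k, hk, rfl⟩ := mem_lev_iff.1 hv
    exact apply_mem_lev.2 (hk.trans h)

theorem lev_injective (e : Fin (M + 1) ≃ σ) : Function.Injective (lev e) := fun _ _ h =>
  le_antisymm (lev_subset_lev_iff.1 h.le) (lev_subset_lev_iff.1 h.ge)

theorem lev_nonempty (e : Fin (M + 1) ≃ σ) (i : Fin (M + 1)) : (lev e i).Nonempty :=
  ⟨e i, apply_mem_lev.2 le_rfl⟩

theorem lev_last (e : Fin (M + 1) ≃ σ) : lev e (Fin.last M) = σ := by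
  refine (lev_subset e _).antisymm fun v hv => ?_
  obtain ⟨j, rfl⟩ := exists_apply_eq e hv
  exact apply_mem_lev.2 (Fin.le_last j)

theorem card_lev (e : Fin (M + 1) ≃ σ) (i : Fin (M + 1)) : (lev e i).card = i + 1 := by
  have h : Function.Injective fun j => (e j : V) := Subtype.val_injective.comp e.injective
  rw [lev, Finset.card_image_of_injective _ h]
  simp

theorem lev_mem_flag (e : Fin (M + 1) ≃ σ) (i : Fin (M + 1)) : lev e i ∈ flag e :=
  Finset.mem_image_of_mem _ (Finset.mem_univ i)

theorem mem_flag {e : Fin (M + 1) ≃ σ} {a : Finset V} : a ∈ flag e ↔ ∃ i, lev e i = a := by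
  simp [flag]

theorem card_flag (e : Fin (M + 1) ≃ σ) : (flag e).card = M + 1 := by
  rw [flag, Finset.card_image_of_injective _ (lev_injective e)]
  simp

theorem flag_chain (e : Fin (M + 1) ≃ σ) :
    ∀ a ∈ flag e, ∀ b ∈ flag e, a ⊆ b ∨ b ⊆ a := by
  intro a ha b hb
  obtain ⟨i, rfl⟩ := mem_flag.1 ha
  obtain ⟨j, rfl⟩ := mem_flag.1 hb
  simpa only [lev_subset_lev_iff] using le_total i j

/-- A maximal flag cannot be enlarged. -/
theorem mem_flag_of_comparable (hσ : σ.card = M + 1) (e : Fin (M + 1) ≃ σ) {a : Finset V}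
    (ha : a ⊆ σ) (hne : a ≠ ∅) (hcomp : ∀ b ∈ flag e, a ⊆ b ∨ b ⊆ a) : a ∈ flag e := by
  have h1 : 0 < a.card := Finset.card_pos.2 (Finset.nonempty_iff_ne_empty.2 hne)
  have h2 := Finset.card_le_card ha
  let i : Fin (M + 1) := ⟨a.card - 1, by omega⟩
  have hc : (lev e i).card = a.card := by
    rw [card_lev]
    simp only [i]
    omega
  refine mem_flag.2 ⟨i, ?_⟩
  rcases hcomp _ (lev_mem_flag e i) with h | h
  · exact (Finset.eq_of_subset_of_card_le h hc.le).symm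
  · exact Finset.eq_of_subset_of_card_le h hc.ge

theorem lev_eq_of_mem_flag {e e' : Fin (M + 1) ≃ σ} {i : Fin (M + 1)}
    (h : lev e i ∈ flag e') : lev e i = lev e' i := by
  obtain ⟨j, hj⟩ := mem_flag.1 h
  have hc := congrArg Finset.card hj
  rw [card_lev, card_lev] at hc
  have : j = i := Fin.ext (by omega)
  rw [← hj, this]

theorem mem_flag_of_initial (e : Fin (M + 1) ≃ σ) {a : Finset V} (ha : a ⊆ σ) (hne : a ≠ ∅)
    (hinit : ∀ i j, j ≤ i → (e i : V) ∈ a → (e j : V) ∈ a) : a ∈ flag e := by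
  obtain ⟨v, hv⟩ := Finset.nonempty_iff_ne_empty.2 hne
  obtain ⟨j, rfl⟩ := exists_apply_eq e (ha hv)
  let I : Finset (Fin (M + 1)) := Finset.univ.filter fun i => (e i : V) ∈ a
  have hI : I.Nonempty := ⟨j, by simpa [I] using hv⟩
  refine mem_flag.2 ⟨I.max' hI, ?_⟩
  ext w
  constructor
  · intro hw
    obtain ⟨k, hk, rfl⟩ := mem_lev_iff.1 hw
    exact hinit _ _ hk (by simpa [I] using I.max'_mem hI)
  · intro hw
    obtain ⟨k, rfl⟩ := exists_apply_eq e (ha hw)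
    exact apply_mem_lev.2 (I.le_max' k (by simpa [I] using hw))

/-- A simplex has an enumeration sorted by a given injective key. -/
theorem exists_strictMono_enum {U : Type*} {τ : Finset U} (hτ : τ.card = M + 1) {κ : U → ℕ}
    (hκ : Set.InjOn κ τ) : ∃ e : Fin (M + 1) ≃ τ, StrictMono fun i => κ (e i) := by
  let e₀ : Fin (M + 1) ≃ τ := (τ.equivFinOfCardEq hτ).symm
  let f : Fin (M + 1) → ℕ := fun i => κ (e₀ i)
  refine ⟨(Tuple.sort f).trans e₀, (Tuple.monotone_sort f).strictMono_of_injective ?_⟩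
  intro i j h
  exact (Tuple.sort f).injective
    (e₀.injective (Subtype.ext (hκ (e₀ _).2 (e₀ _).2 h)))

theorem enum_eq_of_strictMono {U : Type*} {τ : Finset U} {κ : U → ℕ} (hκ : Set.InjOn κ τ)
    {e e' : Fin (M + 1) ≃ τ}
    (he : StrictMono fun i => κ (e i)) (he' : StrictMono fun i => κ (e' i)) : e = e' := by
  have hr : ∀ e : Fin (M + 1) ≃ τ, Set.range (fun i => κ (e i)) = κ '' τ := by
    intro e
    ext n
    constructor
    · rintro ⟨i, rfl⟩
      exact ⟨_, (e i).2, rfl⟩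
    · rintro ⟨v, hv, rfl⟩
      obtain ⟨j, rfl⟩ := exists_apply_eq e hv
      exact ⟨j, rfl⟩
  have := (he.range_inj he').1 ((hr e).trans (hr e').symm)
  ext i
  exact hκ (e i).2 (e' i).2 (congrFun this i)

theorem exists_injOn_bounded (σ : Finset V) :
    ∃ f : V → ℕ, Set.InjOn f σ ∧ ∀ v, f v ≤ σ.card := by
  refine ⟨fun v => σ.toList.idxOf v, ?_, fun v => ?_⟩
  · intro v hv w _ h
    exact (List.idxOf_inj (by simpa using hv)).1 h
  · simpa using List.idxOf_le_length (a := v) (l := σ.toList)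

/-- Any key may be refined into one which is injective on `σ`. -/
theorem exists_injOn_refinement (σ : Finset V) (f : V → ℕ) :
    ∃ r : V → ℕ, Set.InjOn r σ ∧ ∀ v w, f v < f w → r v < r w := by
  obtain ⟨g, hg, hb⟩ := exists_injOn_bounded σ
  have key : ∀ v w, f v < f w →
      f v * (σ.card + 1) + g v < f w * (σ.card + 1) + g w := by
    intro v w h
    have := Nat.mul_le_mul_right (σ.card + 1) (Nat.succ_le_of_lt h)
    have := hb v
    rw [Nat.succ_mul] at *
    omega
  refine ⟨fun v => f v * (σ.card + 1) + g v, ?_, key⟩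
  intro v hv w hw h
  rcases lt_trichotomy (f v) (f w) with h' | h' | h'
  · exact absurd h (key v w h').ne
  · refine hg hv hw ?_
    simpa [h'] using h
  · exact absurd h (key w v h').ne'

/-- Every flag of `σ` is contained in a maximal one. -/
theorem exists_subset_flag (hσ : σ.card = M + 1) {c : Finset (Finset V)}
    (hc : ∀ a ∈ c, a ⊆ σ ∧ a ≠ ∅) (hchain : ∀ a ∈ c, ∀ b ∈ c, a ⊆ b ∨ b ⊆ a) :
    ∃ e : Fin (M + 1) ≃ σ, c ⊆ flag e := by
  obtain ⟨r, hr, hlt⟩ := exists_injOn_refinement σ fun v => (c.filter fun a => v ∉ a).card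
  obtain ⟨e, he⟩ := exists_strictMono_enum hσ hr
  refine ⟨e, fun a ha => mem_flag_of_initial e (hc a ha).1 (hc a ha).2 fun i j hji hi => ?_⟩
  by_contra hj
  refine (he.monotone hji).not_gt (hlt _ _ (Finset.card_lt_card ?_))
  rw [Finset.ssubset_iff_of_subset]
  · exact ⟨a, by simp [ha, hj], by simp [hi]⟩
  · intro b hb
    simp only [Finset.mem_filter] at hb ⊢
    refine ⟨hb.1, fun hjb => ?_⟩
    rcases hchain a ha b hb.1 with h | h
    · exact hb.2 (h hi)
    · exact hj (h hjb)

end Flags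

/-! ### Restriction sets of maximal flags -/

section Restriction

variable {σ : Finset V} {M : ℕ}

/-- A linear order `r` on `σ` together with, for each `x ∈ σ`, a linear order `L x` in which
the elements preceding `x` are the same as for `r`. -/
structure IsVertexOrder (σ : Finset V) (r : V → ℕ) (L : V → V → ℕ) : Prop where
  injOn : Set.InjOn r σ
  injOn_of_mem : ∀ x ∈ σ, Set.InjOn (L x) σ
  lt_iff : ∀ x ∈ σ, ∀ y ∈ σ, L x y < L x x ↔ r y < r x

/-- The enumeration `e` has a descent at `i`, for the order attached to its first vertex. -/
def IsDescent (L : V → V → ℕ) (e : Fin (M + 1) ≃ σ) (i : Fin M) : Prop :=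
  L (e 0) (e i.succ) < L (e 0) (e i.castSucc)

instance (L : V → V → ℕ) (e : Fin (M + 1) ≃ σ) : DecidablePred (IsDescent L e) :=
  fun _ => inferInstanceAs (Decidable (_ < _))

/-- The restriction set of the maximal flag associated with `e`. -/
def descSet (L : V → V → ℕ) (e : Fin (M + 1) ≃ σ) : Finset (Finset V) :=
  (Finset.univ.filter (IsDescent L e)).image fun i => lev e i.castSucc

theorem lev_castSucc_mem_descSet {L : V → V → ℕ} {e : Fin (M + 1) ≃ σ} {i : Fin M} :
    lev e i.castSucc ∈ descSet L e ↔ IsDescent L e i := by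
  simp only [descSet, Finset.mem_image, Finset.mem_filter, Finset.mem_univ, true_and]
  constructor
  · rintro ⟨j, hj, h⟩
    rwa [← Fin.castSucc_injective _ (lev_injective e h)]
  · exact fun h => ⟨i, h, rfl⟩

theorem descSet_subset_flag (L : V → V → ℕ) (e : Fin (M + 1) ≃ σ) : descSet L e ⊆ flag e := by
  intro a ha
  obtain ⟨i, -, rfl⟩ := Finset.mem_image.1 ha
  exact lev_mem_flag e _

theorem last_notMem_descSet (hσ : σ.card = M + 1) (L : V → V → ℕ) (e : Fin (M + 1) ≃ σ) :
    σ ∉ descSet L e := by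
  intro h
  obtain ⟨i, -, hi⟩ := Finset.mem_image.1 h
  have := card_lev e i.castSucc
  rw [hi, hσ] at this
  have := i.2
  simp at *
  omega

theorem le_of_forall_succ {α : Type*} [Preorder α] (f : Fin (M + 1) → α) {i j : Fin (M + 1)}
    (hij : i ≤ j)
    (h : ∀ k : Fin M, i ≤ k.castSucc → k.castSucc < j → f k.castSucc ≤ f k.succ) :
    f i ≤ f j := by
  induction j using Fin.induction with
  | zero => rw [Fin.le_zero_iff.1 hij]
  | succ j ih =>
    rcases hij.eq_or_lt with rfl | hlt
    · exact le_rfl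
    · have hj := Fin.le_castSucc_iff.2 hlt
      exact (ih hj fun k hk hkj => h k hk (hkj.trans Fin.castSucc_lt_succ)).trans
        (h j hj Fin.castSucc_lt_succ)

theorem le_of_no_descent {U : Type*} {τ : Finset U} {L : U → U → ℕ} {e : Fin (M + 1) ≃ τ}
    {i j : Fin (M + 1)}
    (hij : i ≤ j)
    (h : ∀ k : Fin M, i ≤ k.castSucc → k.castSucc < j → ¬ IsDescent L e k) :
    L (e 0) (e i) ≤ L (e 0) (e j) :=
  le_of_forall_succ (fun k => L (e 0) (e k)) hij fun k hk hkj => not_lt.1 (h k hk hkj)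

theorem le_of_descents {U : Type*} {τ : Finset U} {L : U → U → ℕ} {e : Fin (M + 1) ≃ τ}
    {i j : Fin (M + 1)}
    (hij : i ≤ j)
    (h : ∀ k : Fin M, i ≤ k.castSucc → k.castSucc < j → IsDescent L e k) :
    L (e 0) (e j) ≤ L (e 0) (e i) :=
  le_of_forall_succ (α := ℕᵒᵈ) (fun k => OrderDual.toDual (L (e 0) (e k))) hij
    fun k hk hkj => (h k hk hkj).le

theorem le_at_first_difference {L : V → V → ℕ} {e e' : Fin (M + 1) ≃ σ}
    {c : Finset (Finset V)} (hc : descSet L e ⊆ c) (hce' : c ⊆ flag e')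
    {i : Fin (M + 1)} (hi : ∀ k < i, (e k : V) = e' k) :
    L (e 0) (e i) ≤ L (e 0) (e' i) := by
  classical
  let J : Finset (Fin (M + 1)) := Finset.univ.filter fun j => i ≤ j ∧ lev e j = lev e' j
  have hJ : J.Nonempty := ⟨Fin.last M, by simp [J, lev_last, Fin.le_last]⟩
  obtain ⟨hij, hlev⟩ : i ≤ J.min' hJ ∧ lev e (J.min' hJ) = lev e' (J.min' hJ) := by
    simpa [J] using J.min'_mem hJ
  have hmem : (e' i : V) ∈ lev e (J.min' hJ) := by
    rw [hlev]
    exact apply_mem_lev.2 hij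
  obtain ⟨k, hk, hke⟩ := mem_lev_iff.1 hmem
  have hik : i ≤ k := by
    by_contra hlt
    have h1 := hi k (not_le.1 hlt)
    rw [hke] at h1
    exact hlt (e'.injective (Subtype.ext h1)).le
  rw [← hke]
  refine le_of_no_descent hik fun l hil hlk hdesc => ?_
  have h1 := hce' (hc (lev_castSucc_mem_descSet.2 hdesc))
  have h2 : l.castSucc ∈ J := by simp [J, hil, lev_eq_of_mem_flag h1]
  exact absurd (J.min'_le _ h2) (not_le.2 (hlk.trans_le hk))

/-- A flag lies between the restriction set and the maximal flag of at most one enumeration. -/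
theorem enum_eq_of_descSet_subset {r : V → ℕ} {L : V → V → ℕ} (hL : IsVertexOrder σ r L)
    {e e' : Fin (M + 1) ≃ σ} {c : Finset (Finset V)} (hc : descSet L e ⊆ c) (hce : c ⊆ flag e)
    (hc' : descSet L e' ⊆ c) (hce' : c ⊆ flag e') : e = e' := by
  have key : ∀ i, (e i : V) = e' i := by
    intro i
    induction i using WellFoundedLT.induction with
    | ind i ih =>
      have h1 := le_at_first_difference hc hce' ih
      have h2 := le_at_first_difference hc' hce fun k hk => (ih k hk).symm
      rcases Fin.eq_zero_or_eq_succ i with rfl | ⟨j, rfl⟩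
      · have h3 := mt (hL.lt_iff _ (e 0).2 _ (e' 0).2).2 h1.not_gt
        have h4 := mt (hL.lt_iff _ (e' 0).2 _ (e 0).2).2 h2.not_gt
        exact hL.injOn (e 0).2 (e' 0).2 (by omega)
      · rw [← ih 0 (Fin.succ_pos j)] at h2
        exact hL.injOn_of_mem _ (e 0).2 (e _).2 (e' _).2 (le_antisymm h1 h2)
  ext i
  exact key i

/-- The key according to which maximal flags are ordered: the rank of the first vertex, then
the lexicographic order. -/
def enumKey (r : V → ℕ) (L : V → V → ℕ) (e : Fin (M + 1) ≃ σ) :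
    ℕ ×ₗ Lex (Fin (M + 1) → ℕ) :=
  toLex (r (e 0), toLex fun i => L (e 0) (e i))

theorem exists_key_lt_of_descent {r : V → ℕ} {L : V → V → ℕ} (hL : IsVertexOrder σ r L)
    {e : Fin (M + 1) ≃ σ} {i : Fin M} (hi : IsDescent L e i) :
    ∃ e' : Fin (M + 1) ≃ σ, enumKey r L e' < enumKey r L e ∧
      (flag e).erase (lev e i.castSucc) ⊆ flag e' := by
  refine ⟨(Equiv.swap i.castSucc i.succ).trans e, ?_, ?_⟩
  · rw [enumKey, enumKey, Prod.Lex.toLex_lt_toLex]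
    rcases Fin.eq_zero_or_eq_succ i.castSucc with h0 | ⟨j, hj⟩
    · left
      unfold IsDescent at hi
      rw [h0] at hi
      simpa [h0] using (hL.lt_iff _ (e 0).2 _ (e _).2).1 hi
    · right
      have h0 : (Equiv.swap i.castSucc i.succ) 0 = 0 :=
        Equiv.swap_apply_of_ne_of_ne (by rw [hj]; exact (Fin.succ_ne_zero j).symm)
          (Fin.succ_ne_zero i).symm
      simp only [Equiv.trans_apply, h0, true_and]
      exact Pi.lex_desc (f := fun k => L (e 0) (e k)) Fin.castSucc_lt_succ.le hi
  · intro a ha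
    obtain ⟨hne, ha⟩ := Finset.mem_erase.1 ha
    obtain ⟨k, rfl⟩ := mem_flag.1 ha
    have hki : k ≠ i.castSucc := fun h => hne (by rw [h])
    refine mem_flag.2 ⟨k, ?_⟩
    refine Finset.eq_of_subset_of_card_le (fun v hv => ?_) (by simp [card_lev])
    obtain ⟨l, hl, rfl⟩ := mem_lev_iff.1 hv
    rw [Equiv.trans_apply, apply_mem_lev, Equiv.swap_apply_def]
    have h1 : (l : ℕ) ≤ k := hl
    have h2 : (k : ℕ) ≠ i := fun h => hki (Fin.ext h)
    split_ifs with h h'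
    · subst h
      simp only [Fin.le_def, Fin.val_succ, Fin.val_castSucc] at *
      omega
    · subst h'
      simp only [Fin.le_def, Fin.val_succ, Fin.val_castSucc] at *
      omega
    · exact hl

/-- Every flag contained in the maximal flag of `e` contains the restriction set of an
enumeration which does not come after `e`. -/
theorem exists_descSet_subset {r : V → ℕ} {L : V → V → ℕ} (hL : IsVertexOrder σ r L)
    (e : Fin (M + 1) ≃ σ) {c : Finset (Finset V)} (hc : c ⊆ flag e) :
    ∃ e' : Fin (M + 1) ≃ σ, (e' = e ∨ enumKey r L e' < enumKey r L e) ∧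
      descSet L e' ⊆ c ∧ c ⊆ flag e' := by
  have wf : WellFounded fun e e' : Fin (M + 1) ≃ σ => enumKey r L e < enumKey r L e' :=
    Finite.wellFounded_of_trans_of_irrefl _
  induction e using wf.induction with
  | h e ih =>
    by_cases h : descSet L e ⊆ c
    · exact ⟨e, Or.inl rfl, h, hc⟩
    · obtain ⟨a, ha, hac⟩ := Finset.not_subset.1 h
      obtain ⟨i, hi, rfl⟩ := Finset.mem_image.1 ha
      obtain ⟨e₁, hlt, hsub⟩ := exists_key_lt_of_descent hL (Finset.mem_filter.1 hi).2
      have hce₁ : c ⊆ flag e₁ := fun b hb =>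
        hsub (Finset.mem_erase.2 ⟨fun h => hac (h ▸ hb), hc hb⟩)
      obtain ⟨e', he', h1, h2⟩ := ih e₁ hlt hce₁
      refine ⟨e', Or.inr ?_, h1, h2⟩
      rcases he' with rfl | he'
      · exact hlt
      · exact he'.trans hlt

end Restriction

/-! ### A vertex order with at most one critical flag -/

section Critical

variable {σ : Finset V} {M : ℕ} {D μ : Finset V}

/-- The faces of the simplex deprived of the ridges opposite to `D` and of the face `μ`. -/
def IsFace (D μ a : Finset V) : Prop := D ⊆ a ∧ ¬ a ⊆ μ

instance (D μ : Finset V) : DecidablePred (IsFace D μ) :=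
  fun _ => inferInstanceAs (Decidable (_ ∧ _))

theorem IsFace.mono {U : Type*} {D μ a b : Finset U} (h : IsFace D μ a) (hab : a ⊆ b) :
    IsFace D μ b :=
  ⟨h.1.trans hab, fun hb => h.2 (hab.trans hb)⟩

theorem isFace_self {U : Type*} {D μ σ : Finset U} (hDμ : D ⊆ μ) (hμ : μ ⊂ σ) : IsFace D μ σ :=
  ⟨hDμ.trans hμ.1, hμ.2⟩

/-- The enumeration `e` is critical when its descents are exactly the indices of the elements of
its flag which are not faces. -/
def IsCritEnum (D μ : Finset V) (L : V → V → ℕ) (e : Fin (M + 1) ≃ σ) : Prop :=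
  ∀ i : Fin M, IsDescent L e i ↔ ¬ IsFace D μ (lev e i.castSucc)

theorem not_isCritEnum_of_pivot {L : V → V → ℕ} (hDμ : D ⊆ μ) (hμ : μ ⊂ σ)
    {e : Fin (M + 1) ≃ σ} {s : V} (hs : s ∈ σ) (hsD : s ∉ D)
    (hmin : ∀ y ∈ σ, y ≠ s → L (e 0) s < L (e 0) y)
    (h : s ∈ μ ∨ ((e 0 : V) ≠ s ∧ (e 0 : V) ∉ μ)) : ¬ IsCritEnum D μ L e := by
  intro hcrit
  obtain ⟨j, rfl⟩ := exists_apply_eq e hs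
  have hface : IsFace D μ (lev e j) := by
    rcases Fin.eq_castSucc_or_eq_last j with ⟨i, rfl⟩ | rfl
    · by_contra hf
      exact ((hcrit i).2 hf).not_gt (hmin _ (e _).2 fun h =>
        Fin.castSucc_lt_succ.ne' (e.injective (Subtype.ext h)))
    · rw [lev_last]
      exact isFace_self hDμ hμ
  rcases Fin.eq_zero_or_eq_succ j with rfl | ⟨i, rfl⟩
  · rcases h with h | h
    · refine hface.2 fun v hv => ?_
      obtain ⟨k, hk, rfl⟩ := mem_lev_iff.1 hv
      rwa [Fin.le_zero_iff.1 hk]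
    · exact h.1 rfl
  · have hlev : ∀ v ∈ lev e i.succ, v = e i.succ ∨ v ∈ lev e i.castSucc := by
      intro v hv
      obtain ⟨k, hk, rfl⟩ := mem_lev_iff.1 hv
      rcases hk.eq_or_lt with rfl | hlt
      · exact Or.inl rfl
      · exact Or.inr (apply_mem_lev.2 (Fin.le_castSucc_iff.2 hlt))
    have hnf : ¬ IsFace D μ (lev e i.castSucc) := by
      rw [← hcrit]
      exact hmin _ (e _).2 fun h =>
        Fin.castSucc_lt_succ.ne (e.injective (Subtype.ext h))
    refine hnf ⟨fun d hd => ?_, fun hsub => ?_⟩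
    · rcases hlev d (hface.1 hd) with rfl | h'
      · exact absurd hd hsD
      · exact h'
    · rcases h with h | h
      · refine hface.2 fun v hv => ?_
        rcases hlev v hv with rfl | h'
        · exact h
        · exact hsub h'
      · exact h.2 (hsub (apply_mem_lev.2 (Fin.zero_le _)))

theorem not_isCritEnum_of_first_mem {L : V → V → ℕ} (hDμ : D ⊆ μ) (hμ : μ ⊂ σ)
    {e : Fin (M + 1) ≃ σ} (h : ∀ y ∈ σ, L (e 0) y ≤ L (e 0) (e 0) → y ∈ μ) :
    ¬ IsCritEnum D μ L e := by
  intro hcrit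
  let J : Finset (Fin (M + 1)) := Finset.univ.filter fun j => IsFace D μ (lev e j)
  have hJ : J.Nonempty := ⟨Fin.last M, by simp [J, lev_last, isFace_self hDμ hμ]⟩
  have hj : IsFace D μ (lev e (J.min' hJ)) := by simpa [J] using J.min'_mem hJ
  refine hj.2 fun v hv => ?_
  obtain ⟨k, hk, rfl⟩ := mem_lev_iff.1 hv
  refine h _ (e k).2 (le_of_descents (Fin.zero_le k) fun l _ hlk => (hcrit l).2 fun hf => ?_)
  exact absurd (J.min'_le l.castSucc (by simpa [J] using hf)) (not_le.2 (hlk.trans_le hk))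

/-- The order `r`, where `s` is moved to the front as soon as the first vertex satisfies `P`. -/
def frontOrder (r : V → ℕ) (P : V → Prop) [DecidablePred P] (s x y : V) : ℕ :=
  if P x ∧ y = s then 0 else r y + 1

theorem isVertexOrder_frontOrder {r : V → ℕ} (hr : Set.InjOn r σ) (P : V → Prop)
    [DecidablePred P] {s : V} (hP : ∀ x ∈ σ, P x → r s < r x) :
    IsVertexOrder σ r (frontOrder r P s) where
  injOn := hr
  injOn_of_mem := by
    intro x hx y hy z hz h
    unfold frontOrder at h
    by_cases h1 : P x ∧ y = s <;> by_cases h2 : P x ∧ z = s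
    · rw [h1.2, h2.2]
    · rw [if_pos h1, if_neg h2] at h
      omega
    · rw [if_neg h1, if_pos h2] at h
      omega
    · rw [if_neg h1, if_neg h2] at h
      exact hr hy hz (by omega)
  lt_iff := by
    intro x hx y hy
    unfold frontOrder
    by_cases h : P x
    · have := hP x hx h
      have hxs : x ≠ s := by
        rintro rfl
        omega
      by_cases hys : y = s
      · subst hys
        simp [hxs, h, this]
      · simp [hxs, hys]
    · simp [h]

theorem frontOrder_lt {U : Type*} [DecidableEq U] {r : U → ℕ} {P : U → Prop} [DecidablePred P]
    {s x y : U} (h : P x) (hy : y ≠ s) : frontOrder r P s x s < frontOrder r P s x y := by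
  simp [frontOrder, h, hy]

theorem frontOrder_of_not {r : V → ℕ} {P : V → Prop} [DecidablePred P] {s x : V} (h : ¬ P x)
    (y : V) : frontOrder r P s x y = r y + 1 := by
  simp [frontOrder, h]

/-- When the rank separates `μ` from its complement, with least element `v₀` there, there is
exactly one critical enumeration starting at `v₀`. -/
theorem exists_unique_isCritEnum (hσ : σ.card = M + 1) {r : V → ℕ} (hr : Set.InjOn r σ)
    {L : V → V → ℕ} {v₀ : V} (hv₀ : v₀ ∈ σ) (hμσ : μ ⊆ σ)
    (hlow : ∀ y ∈ μ, r y < r v₀) (hhigh : ∀ y ∈ σ, y ∉ μ → r v₀ ≤ r y)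
    (hL : ∀ y, L v₀ y = r y + 1) :
    ∃ e₀ : Fin (M + 1) ≃ σ, IsCritEnum μ μ L e₀ ∧ (e₀ 0 : V) = v₀ ∧
      (descSet L e₀).card = μ.card ∧
      ∀ e : Fin (M + 1) ≃ σ, (e 0 : V) = v₀ → IsCritEnum μ μ L e → e = e₀ := by
  have hB : ∀ y ∈ σ, r y ≤ σ.sup r := fun y hy => Finset.le_sup hy
  have hμ : ∀ y ∈ σ, y ∈ μ ↔ r y < r v₀ := fun y hy =>
    ⟨hlow y, fun h => by_contra fun h' => (hhigh y hy h').not_gt h⟩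
  have hv₀μ : v₀ ∉ μ := fun h => (hlow _ h).false
  let κ : V → ℕ := fun y => if r y ≤ r v₀ then σ.sup r - r y else σ.sup r + r y
  have hκlt : ∀ y ∈ σ, ∀ z ∈ σ, κ y < κ z ↔
      (r z ≤ r v₀ ∧ r z < r y ∧ r y ≤ r v₀) ∨ (r v₀ < r z ∧ r y < r z) := by
    intro y hy z hz
    have h1 := hB y hy
    have h2 := hB z hz
    have h3 := hB v₀ hv₀
    simp only [κ]
    split_ifs <;> omega
  have hκ : Set.InjOn κ σ := by
    intro y hy z hz h
    have h1 := (hκlt y hy z hz).not.1 h.not_lt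
    have h2 := (hκlt z hz y hy).not.1 h.not_gt
    refine hr hy hz ?_
    omega
  have hdesc : ∀ e : Fin (M + 1) ≃ σ, (e 0 : V) = v₀ → ∀ i : Fin M,
      IsDescent L e i ↔ r (e i.succ) < r (e i.castSucc) := by
    intro e he i
    rw [IsDescent, he, hL, hL]
    omega
  have hface : ∀ e : Fin (M + 1) ≃ σ, (e 0 : V) = v₀ → ∀ i,
      ¬ IsFace μ μ (lev e i) ↔ ∃ j, i < j ∧ (e j : V) ∈ μ := by
    intro e he i
    have h0 : ¬ lev e i ⊆ μ := fun h =>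
      hv₀μ (he ▸ h (apply_mem_lev.2 (Fin.zero_le i)))
    rw [IsFace, not_and_not_right]
    constructor
    · intro h
      obtain ⟨v, hv, hvi⟩ := Finset.not_subset.1 fun h' => h0 (h h')
      obtain ⟨j, rfl⟩ := exists_apply_eq e (hμσ hv)
      exact ⟨j, not_le.1 fun hj => hvi (apply_mem_lev.2 hj), hv⟩
    · rintro ⟨j, hij, hj⟩ h
      exact absurd (apply_mem_lev.1 (h hj)) (not_le.2 hij)
  obtain ⟨e₀, he₀⟩ := exists_strictMono_enum hσ hκ
  have hfirst : (e₀ 0 : V) = v₀ := by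
    obtain ⟨j, hj⟩ := exists_apply_eq e₀ hv₀
    by_contra hne
    have hj0 : 0 < j := by
      rcases Fin.eq_zero_or_eq_succ j with rfl | ⟨i, rfl⟩
      · exact absurd hj hne
      · exact Fin.succ_pos i
    have h1 := (hκlt _ (e₀ 0).2 _ (e₀ j).2).1 (he₀ hj0)
    rw [hj] at h1
    omega
  have hmemμ : ∀ i : Fin M, IsDescent L e₀ i ↔ (e₀ i.succ : V) ∈ μ := by
    intro i
    have h1 := (hκlt _ (e₀ _).2 _ (e₀ _).2).1 (he₀ (Fin.castSucc_lt_succ (i := i)))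
    rw [hdesc e₀ hfirst, hμ _ (e₀ _).2]
    omega
  have hcrit : IsCritEnum μ μ L e₀ := by
    intro i
    rw [hface e₀ hfirst, hmemμ]
    constructor
    · exact fun h => ⟨_, Fin.castSucc_lt_succ, h⟩
    · rintro ⟨j, hij, hj⟩
      have hle := he₀.monotone (Fin.castSucc_lt_iff_succ_le.1 hij)
      have h1 := (hκlt _ (e₀ j).2 _ (e₀ i.succ).2).not.1 (not_lt.2 hle)
      rw [hμ _ (e₀ _).2] at hj ⊢
      have h2 := (hκlt _ (e₀ 0).2 _ (e₀ i.succ).2).1 (he₀ (Fin.succ_pos i))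
      rw [hfirst] at h2
      omega
  refine ⟨e₀, hcrit, hfirst, ?_, fun e he hcrit => enum_eq_of_strictMono hκ ?_ he₀⟩
  · have hinj : Function.Injective fun i : Fin M => lev e₀ i.castSucc :=
      (lev_injective e₀).comp (Fin.castSucc_injective M)
    rw [descSet, Finset.card_image_of_injective _ hinj]
    refine Finset.card_bij (fun i _ => (e₀ i.succ : V)) ?_ ?_ ?_
    · intro i hi
      exact (hmemμ i).1 (Finset.mem_filter.1 hi).2
    · intro i _ j _ h
      exact Fin.succ_injective _ (e₀.injective (Subtype.ext h))
    · intro v hv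
      obtain ⟨j, rfl⟩ := exists_apply_eq e₀ (hμσ hv)
      rcases Fin.eq_zero_or_eq_succ j with rfl | ⟨i, rfl⟩
      · exact absurd (hfirst ▸ hv) hv₀μ
      · exact ⟨i, by simpa using (hmemμ i).2 hv, rfl⟩
  · rw [Fin.strictMono_iff_lt_succ]
    intro i
    rw [hκlt _ (e _).2 _ (e _).2]
    by_cases hd : IsDescent L e i
    · left
      have hnf := (hcrit i).1 hd
      have h1 : L (e 0) (e i.castSucc) ≤ L (e 0) (e 0) :=
        le_of_descents (Fin.zero_le _) fun k _ hk => (hcrit k).2 fun hf =>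
          hnf (hf.mono (lev_subset_lev_iff.2 hk.le))
      rw [he, hL, hL] at h1
      have h2 := (hdesc e he i).1 hd
      omega
    · right
      have h1 := (hface e he _).not.1 ((hcrit i).not.1 hd)
      have h2 : (e i.succ : V) ∉ μ := fun h => h1 ⟨_, Fin.castSucc_lt_succ, h⟩
      have h3 : r (e i.succ) ≠ r v₀ := by
        rw [← he]
        exact fun h => (Fin.succ_ne_zero i) (e.injective (Subtype.ext (hr (e _).2 (e _).2 h)))
      have h4 : r (e i.succ) ≠ r (e i.castSucc) := fun h =>
        Fin.castSucc_lt_succ.ne' (e.injective (Subtype.ext (hr (e _).2 (e _).2 h)))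
      have h5 := hhigh _ (e _).2 h2
      have h6 := (hdesc e he i).not.1 hd
      omega

/-- There is a vertex order beginning with `α` which has no critical enumeration, unless `D = μ`,
in which case it has exactly one, and this one does not begin in `α`. -/
theorem exists_vertexOrder (hσ : σ.card = M + 1) (hDμ : D ⊆ μ) (hμ : μ ⊂ σ) {α : Finset V}
    (hα : α ⊆ μ) :
    ∃ (r : V → ℕ) (L : V → V → ℕ), IsVertexOrder σ r L ∧
      (∀ a ∈ α, ∀ b ∈ σ, r b ≤ r a → b ∈ α) ∧
      (D ≠ μ → ∀ e : Fin (M + 1) ≃ σ, ¬ IsCritEnum D μ L e) ∧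
      (D = μ → ∃ e₀ : Fin (M + 1) ≃ σ, IsCritEnum D μ L e₀ ∧ (e₀ 0 : V) ∉ α ∧
        (descSet L e₀).card = D.card ∧ ∀ e : Fin (M + 1) ≃ σ, IsCritEnum D μ L e → e = e₀) := by
  by_cases hαD : α ⊆ D
  swap
  · obtain ⟨s, hsα, hsD⟩ := Finset.not_subset.1 hαD
    obtain ⟨r, hr, hlt⟩ := exists_injOn_refinement σ fun y =>
      if y = s then 0 else if y ∈ α then 1 else 2
    refine ⟨r, frontOrder r (fun _ => False) s,
      isVertexOrder_frontOrder hr _ (fun _ _ h => h.elim), ?_, ?_, ?_⟩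
    · intro a ha b _ hba
      by_contra hb
      refine hba.not_gt (hlt _ _ ?_)
      have : b ≠ s := fun h => hb (h ▸ hsα)
      by_cases has : a = s <;> simp [has, ha, hb, this]
    · intro _ e
      refine not_isCritEnum_of_pivot hDμ hμ (hμ.1 (hα hsα)) hsD (fun y _ hys => ?_)
        (Or.inl (hα hsα))
      rw [frontOrder_of_not not_false, frontOrder_of_not not_false]
      refine Nat.succ_lt_succ (hlt _ _ ?_)
      by_cases hy : y ∈ α <;> simp [hys, hy]
    · exact fun h => absurd (h ▸ hα) hαD
  obtain ⟨r, hr, hlt⟩ := exists_injOn_refinement σ fun y =>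
    if y ∈ α then 0 else if y ∈ μ then 1 else 2
  have hrα : ∀ a ∈ α, ∀ b ∈ σ, r b ≤ r a → b ∈ α := by
    intro a ha b _ hba
    by_contra hb
    refine hba.not_gt (hlt _ _ ?_)
    by_cases hbμ : b ∈ μ <;> simp [ha, hb, hbμ]
  have hrμ : ∀ a ∈ μ, ∀ b, b ∉ μ → r a < r b := by
    intro a ha b hb
    have hbα : b ∉ α := fun h => hb (hα h)
    refine hlt _ _ ?_
    by_cases haα : a ∈ α <;> simp [haα, ha, hb, hbα]
  by_cases hD : D = μ
  · subst hD
    obtain ⟨v₀, hv₀, hmin⟩ := Finset.exists_min_image (σ \ D) r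
      (Finset.sdiff_nonempty.2 hμ.2)
    obtain ⟨hv₀σ, hv₀D⟩ := Finset.mem_sdiff.1 hv₀
    let P : V → Prop := fun x => x ∉ D ∧ x ≠ v₀
    have hP : ∀ x ∈ σ, P x → r v₀ < r x := fun x hx h =>
      (hmin x (Finset.mem_sdiff.2 ⟨hx, h.1⟩)).lt_of_ne fun h' => h.2 (hr hv₀σ hx h').symm
    obtain ⟨e₀, h1, h2, h3, h4⟩ := exists_unique_isCritEnum (L := frontOrder r P v₀) hσ hr hv₀σ
      hμ.1 (fun y hy => hrμ y hy _ hv₀D) (fun y hy hyD => hmin y (Finset.mem_sdiff.2 ⟨hy, hyD⟩))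
      (frontOrder_of_not fun h => h.2 rfl)
    refine ⟨r, frontOrder r P v₀, isVertexOrder_frontOrder hr P hP, hrα, fun h => absurd rfl h,
      fun _ => ⟨e₀, h1, ?_, h3, fun e he => h4 e ?_ he⟩⟩
    · rw [h2]
      exact fun h => hv₀D (hα h)
    · by_contra hne
      by_cases h0 : (e 0 : V) ∈ D
      · refine not_isCritEnum_of_first_mem hDμ hμ (fun y hy hle => ?_) he
        rw [frontOrder_of_not fun h => h.1 h0, frontOrder_of_not fun h => h.1 h0] at hle
        by_contra hyD
        have := hrμ _ h0 _ hyD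
        omega
      · exact not_isCritEnum_of_pivot hDμ hμ hv₀σ hv₀D
          (fun y _ hy => frontOrder_lt (P := P) ⟨h0, hne⟩ hy) (Or.inr ⟨hne, h0⟩) he
  · obtain ⟨s, hsμ, hsD⟩ := Finset.not_subset.1 fun h => hD (hDμ.antisymm h)
    refine ⟨r, frontOrder r (fun x => x ∉ μ) s,
      isVertexOrder_frontOrder hr _ (fun x _ h => hrμ s hsμ x h), hrα, fun _ e he => ?_,
      fun h => absurd h hD⟩
    by_cases h0 : (e 0 : V) ∈ μ
    · refine not_isCritEnum_of_first_mem hDμ hμ (fun y hy hle => ?_) he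
      rw [frontOrder_of_not (P := fun x => x ∉ μ) (not_not.2 h0),
        frontOrder_of_not (P := fun x => x ∉ μ) (not_not.2 h0)] at hle
      by_contra hyD
      have := hrμ _ h0 _ hyD
      omega
    · exact not_isCritEnum_of_pivot hDμ hμ (hμ.1 hsμ) hsD
        (fun y _ hy => frontOrder_lt (P := fun x => x ∉ μ) h0 hy) (Or.inl hsμ) he

end Critical

/-! ### Morse tiles described by their faces -/

section Tiles

/-- The simplex `F` deprived of its ridges opposite to the vertices of `R` and of its
face `μ`. -/
def faceTile (F R μ : Finset V) : RelCplx V :=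
  ⟨F.powerset, F.powerset.filter fun c => ¬ IsFace R μ c⟩

theorem mem_faceTile_faces {F R μ c : Finset V} :
    c ∈ (faceTile F R μ).faces ↔ c ⊆ F ∧ IsFace R μ c := by
  simp only [RelCplx.faces, faceTile, Finset.mem_sdiff, Finset.mem_filter, Finset.mem_powerset]
  tauto

@[simp]
theorem mem_faceTile_L {F R μ c : Finset V} :
    c ∈ (faceTile F R μ).L ↔ c ⊆ F ∧ ¬ IsFace R μ c := by
  simp [faceTile]

theorem sup_id_powerset (F : Finset V) : F.powerset.sup id = F :=
  le_antisymm (Finset.sup_le fun _ h => Finset.mem_powerset.1 h)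
    (Finset.le_sup (f := id) (Finset.mem_powerset_self F))

theorem mem_below_iff {F : Finset V} {R : Finset (Finset V)} (hR : R ⊆ ridges F)
    {c : Finset V} : c ∈ below F R ↔ c ⊆ F ∧ ¬ restSet F R ⊆ c := by
  simp only [below, Finset.mem_filter, Finset.mem_powerset, Finset.not_subset, restSet]
  refine and_congr_right fun hc => ⟨?_, ?_⟩
  · rintro ⟨ρ, hρ, hcρ⟩
    obtain ⟨v, hv, rfl⟩ := Finset.mem_image.1 (hR hρ)
    exact ⟨v, ⟨hv, hρ⟩, fun h => Finset.notMem_erase v F (hcρ h)⟩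
  · rintro ⟨v, ⟨_, hρ⟩, hvc⟩
    exact ⟨_, hρ, Finset.subset_erase.2 ⟨hc, hvc⟩⟩

theorem restSet_subset (F : Finset V) (R : Finset (Finset V)) : restSet F R ⊆ F :=
  Finset.filter_subset _ _

theorem card_restSet {F : Finset V} {R : Finset (Finset V)} (hR : R ⊆ ridges F) :
    (restSet F R).card = R.card := by
  refine Finset.card_bij (fun v _ => F.erase v) (fun v hv => (Finset.mem_filter.1 hv).2) ?_ ?_
  · intro v hv w hw h
    exact Finset.erase_injOn F (restSet_subset F R hv) (restSet_subset F R hw) h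
  · intro ρ hρ
    obtain ⟨v, hv, rfl⟩ := Finset.mem_image.1 (hR hρ)
    exact ⟨v, Finset.mem_filter.2 ⟨hv, hρ⟩, rfl⟩

theorem exists_ridges {F R : Finset V} (hR : R ⊆ F) :
    ∃ Q ⊆ ridges F, restSet F Q = R := by
  refine ⟨R.image fun v => F.erase v, Finset.image_subset_image hR, ?_⟩
  ext v
  simp only [restSet, Finset.mem_filter, Finset.mem_image]
  constructor
  · rintro ⟨hv, w, hw, h⟩
    rwa [← Finset.erase_injOn F (hR hw) hv h]
  · exact fun hv => ⟨hR hv, v, hv, rfl⟩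

theorem mem_below_singleton {F μ c : Finset V} : c ∈ below F {μ} ↔ c ⊆ F ∧ c ⊆ μ := by
  simp [below]

theorem mem_below_union_iff {F μ : Finset V} {R : Finset (Finset V)} (hR : R ⊆ ridges F)
    {c : Finset V} :
    c ∈ below F R ∪ below F {μ} ↔ c ⊆ F ∧ ¬ IsFace (restSet F R) μ c := by
  rw [Finset.mem_union, mem_below_iff hR, mem_below_singleton, IsFace]
  tauto

theorem isMorseTile_faceTile {F R μ : Finset V} (hR : R ⊆ F) (hμ : μ ⊂ F) :
    ∃ n k, IsMorseTile (faceTile F R μ) n k := by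
  have hlt := Finset.card_lt_card hμ
  have hcard : F.card = F.card - 1 + 1 := by omega
  by_cases hRμ : R ⊆ μ
  · by_cases hc : μ.card + 2 ≤ F.card
    · obtain ⟨Q, hQ, rfl⟩ := exists_ridges hR
      refine ⟨_, _, F, hcard, rfl, Q, hQ, rfl, Or.inr ⟨μ, hμ.1, ?_, hc, ?_⟩⟩
      · rw [mem_below_iff hQ]
        exact fun h => h.2 hRμ
      · ext c
        rw [mem_below_union_iff hQ, mem_faceTile_L]
    · obtain ⟨w, hw, hwμ⟩ := Finset.exists_of_ssubset hμ
      have hF : insert w μ = F := by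
        refine Finset.eq_of_subset_of_card_le (Finset.insert_subset hw hμ.1) ?_
        rw [Finset.card_insert_of_notMem hwμ]
        omega
      obtain ⟨Q, hQ, hQR⟩ := exists_ridges (Finset.insert_subset hw hR)
      refine ⟨_, _, F, hcard, rfl, Q, hQ, rfl, Or.inl ?_⟩
      ext c
      rw [mem_below_iff hQ, hQR, mem_faceTile_L, IsFace, Finset.insert_subset_iff]
      refine and_congr_right fun hc => not_congr ?_
      rw [and_comm]
      refine and_congr_left fun _ => ⟨fun h => ?_, fun h h' => hwμ (h' h)⟩
      by_contra hwc
      refine h fun v hv => ?_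
      have hv' := hc hv
      rw [← hF, Finset.mem_insert] at hv'
      rcases hv' with rfl | hv'
      · exact absurd hv hwc
      · exact hv'
  · obtain ⟨Q, hQ, rfl⟩ := exists_ridges hR
    refine ⟨_, _, F, hcard, rfl, Q, hQ, rfl, Or.inl ?_⟩
    ext c
    rw [mem_below_iff hQ, mem_faceTile_L, IsFace]
    exact and_congr_right fun _ => not_congr
      ⟨fun h => h.1, fun h => ⟨h, fun h' => hRμ (h.trans h')⟩⟩

theorem isCriticalTile_faceTile {F R : Finset V} {n : ℕ} (hF : F.card = n + 1) (hR : R ⊂ F) :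
    IsCriticalTile (faceTile F R R) n R.card := by
  have hlt := Finset.card_lt_card hR
  obtain ⟨Q, hQ, rfl⟩ := exists_ridges hR.1
  refine ⟨F, hF, rfl, Or.inr ⟨by omega, Q, hQ, (card_restSet hQ).symm, ?_⟩⟩
  ext c
  rw [mem_below_union_iff hQ, mem_faceTile_L]

theorem eq_of_isCriticalTile_faceTile {F R μ : Finset V} (hR : R ⊆ F) (hμ : μ ⊆ F) {w : V}
    (hw : w ∈ F) (hwR : w ∉ R) (hwμ : w ∉ μ) {n k : ℕ}
    (h : IsCriticalTile (faceTile F R μ) n k) : R = μ := by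
  obtain ⟨G, hcard, hG, h⟩ := h
  obtain rfl : F = G := Finset.powerset_inj.1 hG
  rcases h with ⟨-, h⟩ | ⟨hk, Q, hQ, hQk, h⟩
  · have : (∅ : Finset V) ∈ (faceTile F R μ).L := by simp [IsFace]
    rw [h] at this
    simp at this
  have key : ∀ c ⊆ F, IsFace R μ c ↔ IsFace (restSet F Q) (restSet F Q) c := by
    intro c hc
    have := congrArg (fun s => c ∈ s) h
    simpa only [mem_below_union_iff hQ, mem_faceTile_L, hc, true_and, eq_iff_iff,
      not_iff_not] using this
  have hCcard := card_restSet hQ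
  have hCF := restSet_subset F Q
  generalize restSet F Q = C at key hCcard hCF
  have hCmem : ∀ y ∈ F, y ∉ C → R ⊆ insert y C := fun y hy hyC =>
    ((key _ (Finset.insert_subset hy hCF)).2 ⟨Finset.subset_insert y C, fun h =>
      hyC (h (Finset.mem_insert_self y C))⟩).1
  have hRw : IsFace R μ (insert w R) := ⟨Finset.subset_insert w R, fun h =>
    hwμ (h (Finset.mem_insert_self w R))⟩
  have hRwF := Finset.insert_subset hw hR
  have hCw := (key _ hRwF).1 hRw
  have hnC : ¬ IsFace R μ C := fun h => ((key C hCF).1 h).2 le_rfl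
  have hnμ : ¬ IsFace C C μ := fun h => ((key μ hμ).2 h).2 le_rfl
  by_cases hCμ : C ⊆ μ
  · have hμC : μ ⊆ C := by
      by_contra h'
      exact hnμ ⟨hCμ, h'⟩
    obtain rfl := hCμ.antisymm hμC
    refine ((Finset.subset_insert_iff_of_notMem hwR).1 (hCmem w hw hwμ)).antisymm ?_
    exact (Finset.subset_insert_iff_of_notMem hwμ).1 hCw.1
  · have hRC : ¬ R ⊆ C := fun h => hnC ⟨h, hCμ⟩
    have hwC : w ∈ C := by
      by_contra hwC
      exact hRC ((Finset.subset_insert_iff_of_notMem hwR).1 (hCmem w hw hwC))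
    obtain ⟨z, hzR, hzC⟩ := Finset.not_subset.1 hRC
    have hFC : F ⊆ insert z C := by
      intro y hy
      by_cases hyC : y ∈ C
      · exact Finset.mem_insert_of_mem hyC
      · rcases Finset.mem_insert.1 (hCmem y hy hyC hzR) with rfl | h'
        · exact Finset.mem_insert_self _ _
        · exact absurd h' hzC
    have hFR : F ⊆ insert w R := by
      refine hFC.trans (Finset.insert_subset (Finset.mem_insert_of_mem hzR) hCw.1)
    have hRμ : R ⊆ μ := by
      by_contra h'
      have := (key R hR).1 ⟨le_rfl, h'⟩
      exact hwR (this.1 hwC)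
    refine hRμ.antisymm fun y hy => ?_
    rcases Finset.mem_insert.1 (hFR (hμ hy)) with rfl | h'
    · exact absurd hy hwμ
    · exact h'

theorem exists_of_isBasicTile {T : RelCplx V} {n k : ℕ} (h : IsBasicTile T n k) :
    ∃ α A : Finset V, α.card = n + 1 ∧ A ⊆ α ∧ T.K = α.powerset ∧
      ∀ c, c ∈ T.L ↔ c ⊆ α ∧ ¬ A ⊆ c := by
  obtain ⟨α, hα, hK, R, hR, -, hL⟩ := h
  refine ⟨α, restSet α R, hα, restSet_subset _ _, hK, fun c => ?_⟩
  rw [hL, mem_below_iff hR]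

theorem exists_of_isMorseTile {T : RelCplx V} {n k : ℕ} (h : IsMorseTile T n k)
    (hb : ¬ ∃ m l, IsBasicTile T m l) :
    ∃ β B μ : Finset V, β.card = n + 1 ∧ B ⊆ μ ∧ μ ⊂ β ∧ T = faceTile β B μ := by
  obtain ⟨β, hβ, hK, R, hR, hk, hL | ⟨μ, hμ, hμR, hcard, hL⟩⟩ := h
  · exact absurd ⟨n, k, β, hβ, hK, R, hR, hk, hL⟩ hb
  refine ⟨β, restSet β R, μ, hβ, ?_, ?_, ?_⟩
  · by_contra h
    exact hμR ((mem_below_iff hR).2 ⟨hμ, h⟩)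
  · refine Finset.ssubset_iff_subset_ne.2 ⟨hμ, ?_⟩
    rintro rfl
    omega
  · obtain ⟨K, L⟩ := T
    simp only [faceTile, RelCplx.mk.injEq]
    refine ⟨hK, ?_⟩
    simp only at hL
    ext c
    rw [hL, mem_below_union_iff hR]
    simp

theorem suppK_of_K_eq {T : RelCplx V} {α : Finset V} (h : T.K = α.powerset) : suppK T = α := by
  rw [suppK, h, sup_id_powerset]

theorem join_eq_faceTile {T : RelCplx V} {α A β B μ : Finset V} (hA : A ⊆ α)
    (hK : T.K = α.powerset) (hL : ∀ c, c ∈ T.L ↔ c ⊆ α ∧ ¬ A ⊆ c)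
    (hB : B ⊆ β) (hd : Disjoint α β) :
    T.join (faceTile β B μ) = faceTile (α ∪ β) (A ∪ B) (α ∪ μ) := by
  have hsplit : ∀ c ⊆ α ∪ β, c ∩ α ∪ c ∩ β = c := fun c hc => by
    rw [← Finset.inter_union_distrib_left, Finset.inter_eq_left.2 hc]
  have hcap : ∀ a ⊆ α, ∀ b ⊆ β, (a ∪ b) ∩ α = a ∧ (a ∪ b) ∩ β = b := by
    intro a ha b hb
    have h1 : b ∩ α = ∅ := Finset.disjoint_iff_inter_eq_empty.1 (hd.symm.mono_left hb)
    have h2 : a ∩ β = ∅ := Finset.disjoint_iff_inter_eq_empty.1 (hd.mono_left ha)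
    rw [Finset.union_inter_distrib_right, Finset.union_inter_distrib_right, h1, h2,
      Finset.inter_eq_left.2 ha, Finset.inter_eq_left.2 hb]
    simp
  have hface : ∀ c ⊆ α ∪ β, IsFace (A ∪ B) (α ∪ μ) c ↔ A ⊆ c ∩ α ∧ IsFace B μ (c ∩ β) := by
    intro c hc
    simp only [IsFace, Finset.union_subset_iff, Finset.subset_inter_iff, hA, hB, and_true,
      and_assoc]
    refine and_congr_right fun _ => and_congr_right fun _ => not_congr ⟨fun h v hv => ?_,
      fun h v hv => ?_⟩
    · rw [Finset.mem_inter] at hv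
      rcases Finset.mem_union.1 (h hv.1) with h' | h'
      · exact absurd hv.2 (Finset.disjoint_left.1 hd h')
      · exact h'
    · rcases Finset.mem_union.1 (hc hv) with h' | h'
      · exact Finset.mem_union_left _ h'
      · exact Finset.mem_union_right _ (h (Finset.mem_inter.2 ⟨hv, h'⟩))
  simp only [RelCplx.join, faceTile, RelCplx.mk.injEq, hK]
  constructor
  · ext c
    simp only [joinF, Finset.mem_image, Finset.mem_product, Finset.mem_powerset, Prod.exists]
    constructor
    · rintro ⟨a, b, ⟨ha, hb⟩, rfl⟩
      exact Finset.union_subset_union ha hb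
    · intro hc
      exact ⟨c ∩ α, c ∩ β, ⟨Finset.inter_subset_right, Finset.inter_subset_right⟩, hsplit c hc⟩
  · ext c
    simp only [joinF, Finset.mem_union, Finset.mem_image, Finset.mem_product, Finset.mem_powerset,
      Prod.exists, Finset.mem_filter, hL]
    constructor
    · rintro (⟨a, b, ⟨⟨ha, hAa⟩, hb⟩, rfl⟩ | ⟨a, b, ⟨ha, hb, hf⟩, rfl⟩)
      · have hab := Finset.union_subset_union ha hb
        refine ⟨hab, ?_⟩
        rw [hface _ hab, (hcap a ha b hb).1]
        exact fun h => hAa h.1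
      · have hab := Finset.union_subset_union ha hb
        refine ⟨hab, ?_⟩
        rw [hface _ hab, (hcap a ha b hb).2]
        exact fun h => hf h.2
    · rintro ⟨hc, hf⟩
      rw [hface _ hc] at hf
      by_cases h : A ⊆ c ∩ α
      · exact Or.inr ⟨c ∩ α, c ∩ β, ⟨Finset.inter_subset_right, Finset.inter_subset_right,
          fun h' => hf ⟨h, h'⟩⟩, hsplit c hc⟩
      · exact Or.inl ⟨c ∩ α, c ∩ β, ⟨⟨Finset.inter_subset_right, h⟩,
          Finset.inter_subset_right⟩, hsplit c hc⟩

theorem exists_bijOn_pair {F R : Finset V} {G Q : Finset W} (hR : R ⊆ F) (hQ : Q ⊆ G)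
    (hFG : F.card = G.card) (hRQ : R.card = Q.card) (w : W) :
    ∃ f : V → W, Set.BijOn f F G ∧ ∀ v ∈ F, f v ∈ Q ↔ v ∈ R := by
  let e₁ : R ≃ Q := Finset.equivOfCardEq hRQ
  let e₂ : ↥(F \ R) ≃ ↥(G \ Q) := Finset.equivOfCardEq (by
    rw [Finset.card_sdiff_of_subset hR, Finset.card_sdiff_of_subset hQ, hFG, hRQ])
  let f : V → W := fun v =>
    if h : v ∈ R then e₁ ⟨v, h⟩ else if h : v ∈ F \ R then e₂ ⟨v, h⟩ else w
  have h₁ : ∀ v (h : v ∈ R), f v = e₁ ⟨v, h⟩ := fun v h => by simp only [f, h, dif_pos]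
  have h₂ : ∀ v (h : v ∈ F \ R), f v = e₂ ⟨v, h⟩ := fun v h => by
    simp only [f, (Finset.mem_sdiff.1 h).2, h, dif_pos, dif_neg, not_false_eq_true]
  have hfQ : ∀ v ∈ F, f v ∈ Q ↔ v ∈ R := by
    intro v hv
    by_cases h : v ∈ R
    · simp [h₁ v h, h]
    · have h' := Finset.mem_sdiff.2 ⟨hv, h⟩
      simp only [h, iff_false, h₂ v h']
      exact (Finset.mem_sdiff.1 (e₂ _).2).2
  refine ⟨f, ⟨?_, ?_, ?_⟩, hfQ⟩
  · intro v hv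
    by_cases h : v ∈ R
    · rw [h₁ v h]
      exact hQ (e₁ _).2
    · rw [h₂ v (Finset.mem_sdiff.2 ⟨hv, h⟩)]
      exact (Finset.mem_sdiff.1 (e₂ _).2).1
  · intro v hv v' hv' h
    have hiff : v ∈ R ↔ v' ∈ R := by rw [← hfQ v hv, ← hfQ v' hv', h]
    by_cases hvR : v ∈ R
    · rw [h₁ v hvR, h₁ v' (hiff.1 hvR)] at h
      exact congrArg Subtype.val (e₁.injective (Subtype.ext h))
    · rw [h₂ v (Finset.mem_sdiff.2 ⟨hv, hvR⟩),
        h₂ v' (Finset.mem_sdiff.2 ⟨hv', fun h' => hvR (hiff.2 h')⟩)] at h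
      exact congrArg Subtype.val (e₂.injective (Subtype.ext h))
  · intro y hy
    by_cases hyQ : y ∈ Q
    · refine ⟨e₁.symm ⟨y, hyQ⟩, hR (e₁.symm _).2, ?_⟩
      rw [h₁ _ (e₁.symm _).2]
      simp
    · have hy' := Finset.mem_sdiff.2 ⟨hy, hyQ⟩
      refine ⟨e₂.symm ⟨y, hy'⟩, (Finset.mem_sdiff.1 (e₂.symm _).2).1, ?_⟩
      rw [h₂ _ (e₂.symm _).2]
      simp

/-- Two critical tiles of the same dimension and index are isomorphic. -/
theorem exists_isRelIso_faceTile {F R : Finset V} {G Q : Finset W} (hR : R ⊆ F) (hQ : Q ⊆ G)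
    (hFG : F.card = G.card) (hRQ : R.card = Q.card) (w : W) :
    ∃ f : V → W, IsRelIso f (faceTile F R R) (faceTile G Q Q) := by
  obtain ⟨f, hf, hfQ⟩ := exists_bijOn_pair hR hQ hFG hRQ w
  have hsub : ∀ c ⊆ F, c.image f ⊆ G := fun c hc =>
    Finset.image_subset_iff.2 fun v hv => hf.mapsTo (hc hv)
  have hinj : ∀ c ⊆ F, ∀ d ⊆ F, c.image f = d.image f → c ⊆ d := by
    intro c hc d hd h v hv
    obtain ⟨u, hu, huv⟩ := Finset.mem_image.1 (h ▸ Finset.mem_image_of_mem f hv)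
    rwa [← hf.injOn (hd hu) (hc hv) huv]
  have hsurj : ∀ d ⊆ G, (F.filter fun v => f v ∈ d).image f = d := by
    intro d hd
    ext y
    simp only [Finset.mem_image, Finset.mem_filter]
    constructor
    · rintro ⟨v, ⟨-, hv⟩, rfl⟩
      exact hv
    · intro hy
      obtain ⟨v, hv, rfl⟩ := hf.surjOn (hd hy)
      exact ⟨v, ⟨hv, hy⟩, rfl⟩
  have hface : ∀ c ⊆ F, IsFace Q Q (c.image f) ↔ IsFace R R c := by
    intro c hc
    refine and_congr ⟨fun h v hv => ?_, fun h y hy => ?_⟩ (not_congr ?_)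
    · obtain ⟨u, hu, huv⟩ := Finset.mem_image.1 (h ((hfQ v (hR hv)).2 hv))
      rwa [← hf.injOn (hc hu) (hR hv) huv]
    · obtain ⟨v, hv, rfl⟩ := hf.surjOn (hQ hy)
      exact Finset.mem_image_of_mem f (h ((hfQ v hv).1 hy))
    · rw [Finset.image_subset_iff]
      exact forall₂_congr fun v hv => hfQ v (hc hv)
  refine ⟨f, ⟨?_, ?_, ?_⟩, ⟨?_, ?_, ?_⟩⟩
  · intro c hc
    simp only [faceTile, Finset.mem_coe, Finset.mem_powerset] at hc ⊢
    exact hsub c hc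
  · intro c hc d hd h
    simp only [faceTile, Finset.mem_coe, Finset.mem_powerset] at hc hd
    exact (hinj c hc d hd h).antisymm (hinj d hd c hc h.symm)
  · intro d hd
    simp only [faceTile, Finset.mem_coe, Finset.mem_powerset] at hd
    exact ⟨F.filter fun v => f v ∈ d, Finset.mem_coe.2 (Finset.mem_powerset.2
      (Finset.filter_subset _ _)), hsurj d hd⟩
  · intro c hc
    rw [Finset.mem_coe, mem_faceTile_L] at hc ⊢
    exact ⟨hsub c hc.1, (hface c hc.1).not.2 hc.2⟩
  · intro c hc d hd h
    rw [Finset.mem_coe, mem_faceTile_L] at hc hd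
    exact (hinj c hc.1 d hd.1 h).antisymm (hinj d hd.1 c hc.1 h.symm)
  · intro d hd
    rw [Finset.mem_coe, mem_faceTile_L] at hd
    have hF := Finset.filter_subset (fun v => f v ∈ d) F
    refine ⟨_, mem_faceTile_L.2 ⟨hF, ?_⟩, hsurj d hd.1⟩
    rw [← hface _ hF, hsurj d hd.1]
    exact hd.2

end Tiles

/-! ### The tiling of the subdivision by maximal flags -/

section Subdivision

variable {σ D μ : Finset V} {M : ℕ} {r : V → ℕ} {L : V → V → ℕ}

theorem mem_sd {K : Finset (Finset V)} (hK : K ≠ ∅) {c : Finset (Finset V)} :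
    c ∈ sd K ↔ (∀ a ∈ c, a ∈ K ∧ a ≠ ∅) ∧ ∀ a ∈ c, ∀ b ∈ c, a ⊆ b ∨ b ⊆ a := by
  simp only [sd, if_neg hK, Finset.mem_filter, Finset.mem_powerset, Finset.subset_iff,
    Finset.mem_erase, and_comm]

theorem isComplex_sd (K : Finset (Finset V)) : IsComplex (sd K) := by
  by_cases hK : K = ∅
  · simp [sd, hK, IsComplex]
  · intro c hc d hd
    rw [mem_sd hK] at hc ⊢
    exact ⟨fun a ha => hc.1 a (hd ha), fun a ha b hb => hc.2 a (hd ha) b (hd hb)⟩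

theorem mem_sd_powerset {c : Finset (Finset V)} :
    c ∈ sd σ.powerset ↔ (∀ a ∈ c, a ⊆ σ ∧ a ≠ ∅) ∧ ∀ a ∈ c, ∀ b ∈ c, a ⊆ b ∨ b ⊆ a := by
  rw [mem_sd (Finset.powerset_nonempty σ).ne_empty]
  simp only [Finset.mem_powerset]

theorem flag_mem_sd (e : Fin (M + 1) ≃ σ) : flag e ∈ sd σ.powerset := by
  refine mem_sd_powerset.2 ⟨fun a ha => ?_, flag_chain e⟩
  obtain ⟨i, rfl⟩ := mem_flag.1 ha
  exact ⟨lev_subset e i, (lev_nonempty e i).ne_empty⟩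

theorem exists_isFace_of_mem_sdR_faces {c : Finset (Finset V)}
    (hc : c ∈ (faceTile σ D μ).sdR.faces) : c ∈ sd σ.powerset ∧ ∃ a ∈ c, IsFace D μ a := by
  obtain ⟨hK, hL⟩ := Finset.mem_sdiff.1 hc
  refine ⟨hK, ?_⟩
  by_contra! h
  have hK' := mem_sd_powerset.1 hK
  have h0 : (∅ : Finset V) ∈ (faceTile σ D μ).L := by simp [IsFace]
  exact hL ((mem_sd (Finset.ne_empty_of_mem h0)).2
    ⟨fun a ha => ⟨mem_faceTile_L.2 ⟨(hK'.1 a ha).1, h a ha⟩, (hK'.1 a ha).2⟩, hK'.2⟩)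

theorem mem_sdR_faces_of_isFace {c : Finset (Finset V)} (hc : c ∈ sd σ.powerset)
    {a : Finset V} (ha : a ∈ c) (hf : IsFace D μ a) : c ∈ (faceTile σ D μ).sdR.faces := by
  refine Finset.mem_sdiff.2 ⟨hc, fun h => ?_⟩
  have h0 : (∅ : Finset V) ∈ (faceTile σ D μ).L := by simp [IsFace]
  exact (mem_faceTile_L.1 (((mem_sd (Finset.ne_empty_of_mem h0)).1 h).1 a ha).1).2 hf

theorem mem_relDerivedNbhd {T : RelCplx V} {α : Finset V} (hT : suppK T = α) (hα : α ⊆ σ)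
    {c : Finset (Finset V)} :
    c ∈ relDerivedNbhd T (faceTile σ D μ) ↔
      c ∈ (faceTile σ D μ).sdR.faces ∧ ∃ v ∈ α, ∀ a ∈ c, v ∈ a := by
  rw [relDerivedNbhd, hT, Finset.mem_inter, and_comm]
  refine and_congr_right fun hc => ?_
  obtain ⟨hK, hL⟩ := Finset.mem_sdiff.1 hc
  have hK' := mem_sd_powerset.1 hK
  rw [Finset.mem_biUnion]
  refine exists_congr fun v => and_congr_right fun hv => ?_
  constructor
  · intro h a ha
    obtain ⟨h1, -⟩ := Finset.mem_sdiff.1 h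
    have h2 := mem_sd_powerset.1 (Finset.mem_filter.1 h1).2
    rcases h2.2 {v} (by simp) a (by simp [ha]) with h | h
    · exact Finset.singleton_subset_iff.1 h
    · rcases Finset.subset_singleton_iff.1 h with rfl | rfl
      · exact absurd rfl (hK'.1 _ ha).2
      · exact Finset.mem_singleton_self v
  · intro h
    refine Finset.mem_sdiff.2 ⟨Finset.mem_filter.2 ⟨hK, mem_sd_powerset.2 ⟨?_, ?_⟩⟩,
      fun h' => hL (Finset.mem_filter.1 h').1⟩
    · intro a ha
      rcases Finset.mem_union.1 ha with ha | ha
      · obtain rfl := Finset.mem_singleton.1 ha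
        exact ⟨Finset.singleton_subset_iff.2 (hα hv), Finset.singleton_ne_empty v⟩
      · exact hK'.1 a ha
    · intro a ha b hb
      rcases Finset.mem_union.1 ha with ha | ha <;> rcases Finset.mem_union.1 hb with hb | hb
      · rw [Finset.mem_singleton.1 ha, Finset.mem_singleton.1 hb]
        exact Or.inl le_rfl
      · rw [Finset.mem_singleton.1 ha]
        exact Or.inl (Finset.singleton_subset_iff.2 (h b hb))
      · rw [Finset.mem_singleton.1 hb]
        exact Or.inr (Finset.singleton_subset_iff.2 (h a ha))
      · exact hK'.2 a ha b hb

/-- The members of the maximal flag of `e` that are not faces of `faceTile σ D μ`. -/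
def lowSet (D μ : Finset V) (e : Fin (M + 1) ≃ σ) : Finset (Finset V) :=
  (flag e).filter fun a => ¬ IsFace D μ a

/-- The tile of the subdivision of `faceTile σ D μ` carried by the maximal flag of `e`. -/
def flagTile (D μ : Finset V) (L : V → V → ℕ) (e : Fin (M + 1) ≃ σ) : RelCplx (Finset V) :=
  faceTile (flag e) (descSet L e) (lowSet D μ e)

theorem mem_flagTile_faces {e : Fin (M + 1) ≃ σ} {c : Finset (Finset V)} :
    c ∈ (flagTile D μ L e).faces ↔
      c ⊆ flag e ∧ descSet L e ⊆ c ∧ ∃ a ∈ c, IsFace D μ a := by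
  rw [flagTile, mem_faceTile_faces, IsFace]
  refine and_congr_right fun hc => and_congr_right fun _ => ?_
  simp only [Finset.not_subset, lowSet, Finset.mem_filter, not_and, not_not]
  exact exists_congr fun a => and_congr_right fun ha => ⟨fun h => h (hc ha), fun h _ => h⟩

theorem last_mem_flag (e : Fin (M + 1) ≃ σ) : σ ∈ flag e :=
  mem_flag.2 ⟨_, lev_last e⟩

theorem last_notMem_lowSet (hDμ : D ⊆ μ) (hμ : μ ⊂ σ) (e : Fin (M + 1) ≃ σ) :
    σ ∉ lowSet D μ e := fun h => (Finset.mem_filter.1 h).2 (isFace_self hDμ hμ)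

theorem lowSet_ssubset (hDμ : D ⊆ μ) (hμ : μ ⊂ σ) (e : Fin (M + 1) ≃ σ) :
    lowSet D μ e ⊂ flag e :=
  Finset.ssubset_iff_subset_ne.2 ⟨Finset.filter_subset _ _, fun h =>
    last_notMem_lowSet hDμ hμ e (h ▸ last_mem_flag e)⟩

theorem descSet_eq_lowSet_iff (hσ : σ.card = M + 1) (hDμ : D ⊆ μ) (hμ : μ ⊂ σ)
    (e : Fin (M + 1) ≃ σ) : descSet L e = lowSet D μ e ↔ IsCritEnum D μ L e := by
  have hlow : ∀ i : Fin M, lev e i.castSucc ∈ lowSet D μ e ↔ ¬ IsFace D μ (lev e i.castSucc) :=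
    fun i => by simp [lowSet, lev_mem_flag]
  constructor
  · intro h i
    rw [← hlow, ← h, lev_castSucc_mem_descSet]
  · intro h
    ext a
    by_cases ha : a ∈ flag e
    · obtain ⟨i, rfl⟩ := mem_flag.1 ha
      induction i using Fin.lastCases with
      | last =>
        rw [lev_last]
        exact iff_of_false (last_notMem_descSet hσ L e) (last_notMem_lowSet hDμ hμ e)
      | cast i => rw [hlow, lev_castSucc_mem_descSet, h i]
    · exact iff_of_false (fun h => ha (descSet_subset_flag L e h))
        fun h => ha (Finset.filter_subset _ _ h)

theorem exists_isCriticalTile_flagTile_iff (hσ : σ.card = M + 1) (hDμ : D ⊆ μ) (hμ : μ ⊂ σ)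
    (e : Fin (M + 1) ≃ σ) :
    (∃ m l, IsCriticalTile (flagTile D μ L e) m l) ↔ IsCritEnum D μ L e := by
  rw [← descSet_eq_lowSet_iff hσ hDμ hμ]
  constructor
  · rintro ⟨m, l, h⟩
    exact eq_of_isCriticalTile_faceTile (descSet_subset_flag L e) (lowSet_ssubset hDμ hμ e).1
      (last_mem_flag e) (last_notMem_descSet hσ L e) (last_notMem_lowSet hDμ hμ e) h
  · intro h
    have hlt := lowSet_ssubset hDμ hμ e
    rw [flagTile, ← h] at *
    exact ⟨_, _, isCriticalTile_faceTile (card_flag e) hlt⟩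

/-- The tiling of the subdivision by the tiles carried by the maximal flags. -/
def flagTiling (hσ : σ.card = M + 1) (hL : IsVertexOrder σ r L) {N : ℕ}
    (ε : Fin N ≃ (Fin (M + 1) ≃ σ)) : Tiling (faceTile σ D μ).sdR N where
  tile i := flagTile D μ L (ε i)
  isFacet i := by
    refine ⟨flag (ε i), flag_mem_sd _, fun c hc hsub => ?_, rfl⟩
    obtain ⟨h1, h2⟩ := mem_sd_powerset.1 hc
    exact (Finset.Subset.antisymm hsub fun a ha => mem_flag_of_comparable hσ _ (h1 a ha).1
      (h1 a ha).2 fun b hb => h2 a ha b (hsub hb)).symm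
  subL i := Finset.filter_subset _ _
  disj i j hij := by
    refine Finset.disjoint_left.2 fun c hi hj => hij (ε.injective ?_)
    rw [mem_flagTile_faces] at hi hj
    exact enum_eq_of_descSet_subset hL hi.2.1 hi.1 hj.2.1 hj.1
  cover := by
    ext c
    simp only [Finset.mem_biUnion, Finset.mem_univ, true_and, mem_flagTile_faces]
    constructor
    · rintro ⟨i, hc, -, a, ha, hf⟩
      exact mem_sdR_faces_of_isFace (isComplex_sd _ _ (flag_mem_sd (ε i)) _ hc) ha hf
    · intro h
      obtain ⟨hK, hf⟩ := exists_isFace_of_mem_sdR_faces h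
      obtain ⟨h1, h2⟩ := mem_sd_powerset.1 hK
      obtain ⟨e, he⟩ := exists_subset_flag hσ h1 h2
      obtain ⟨e', -, hd, hc⟩ := exists_descSet_subset hL e he
      exact ⟨ε.symm e', by simpa using hc, by simpa using hd, hf⟩

theorem flagTiling_isMorse (hσ : σ.card = M + 1) (hL : IsVertexOrder σ r L) (hDμ : D ⊆ μ)
    (hμ : μ ⊂ σ) {N : ℕ} (ε : Fin N ≃ (Fin (M + 1) ≃ σ)) :
    (flagTiling (D := D) (μ := μ) hσ hL ε).IsMorse := fun _ =>
  isMorseTile_faceTile (descSet_subset_flag L _) (lowSet_ssubset hDμ hμ _)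

theorem Tiling.mem_prefixFaces {S : RelCplx W} {N : ℕ} {T : Tiling S N} {p : ℕ} {c : Finset W} :
    c ∈ T.prefixFaces p ↔ ∃ i : Fin N, (i : ℕ) < p ∧ c ∈ (T.tile i).faces := by
  simp [Tiling.prefixFaces]

theorem flagTiling_isShelling (hσ : σ.card = M + 1) (hL : IsVertexOrder σ r L) {N : ℕ}
    {ε : Fin N ≃ (Fin (M + 1) ≃ σ)} (hε : Monotone fun i => enumKey r L (ε i)) :
    (flagTiling (D := D) (μ := μ) hσ hL ε).IsShelling := by
  intro p _ c hc d hd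
  rcases Finset.mem_union.1 hc with hc | hc
  · exact Finset.mem_union_left _ (isComplex_sd _ c hc d hd)
  obtain ⟨i, hi, hc⟩ := Tiling.mem_prefixFaces.1 hc
  have hc' := (mem_flagTile_faces.1 hc).1
  have hdf := hd.trans hc'
  by_cases hdL : d ∈ sd (faceTile σ D μ).L
  · exact Finset.mem_union_left _ hdL
  refine Finset.mem_union_right _ (Tiling.mem_prefixFaces.2 ?_)
  obtain ⟨-, hf⟩ := exists_isFace_of_mem_sdR_faces (Finset.mem_sdiff.2
    ⟨isComplex_sd _ _ (flag_mem_sd (ε i)) _ hdf, hdL⟩)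
  obtain ⟨e', he', hd1, hd2⟩ := exists_descSet_subset hL (ε i) hdf
  have hle : ε.symm e' ≤ i := by
    rcases he' with rfl | hlt
    · simp
    · by_contra! h
      have := hε h.le
      simp only [Equiv.apply_symm_apply] at this
      exact this.not_gt hlt
  refine ⟨ε.symm e', lt_of_le_of_lt hle hi, mem_flagTile_faces.2 ?_⟩
  rw [Equiv.apply_symm_apply]
  exact ⟨hd2, hd1, hf⟩

theorem exists_forall_mem_iff_of_mem_flagTile (hL : IsVertexOrder σ r L) {α : Finset V}
    (hα : ∀ a ∈ α, ∀ b ∈ σ, r b ≤ r a → b ∈ α) (hασ : α ⊆ σ) {e : Fin (M + 1) ≃ σ}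
    {c : Finset (Finset V)} (hc : c ∈ (flagTile D μ L e).faces) :
    (∃ v ∈ α, ∀ a ∈ c, v ∈ a) ↔ (e 0 : V) ∈ α := by
  obtain ⟨hc, hd, -⟩ := mem_flagTile_faces.1 hc
  constructor
  · rintro ⟨v, hv, h⟩
    obtain ⟨j, rfl⟩ := exists_apply_eq e (hασ hv)
    have hle : L (e 0) (e 0) ≤ L (e 0) (e j) := by
      refine le_of_no_descent (Fin.zero_le _) fun k _ hkj hk => ?_
      have := apply_mem_lev.1 (h _ (hd (lev_castSucc_mem_descSet.2 hk)))
      exact this.not_gt hkj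
    have := (hL.lt_iff _ (e 0).2 _ (e j).2).not.1 hle.not_gt
    exact hα _ hv _ (e 0).2 (not_lt.1 this)
  · intro h
    refine ⟨_, h, fun a ha => ?_⟩
    obtain ⟨i, rfl⟩ := mem_flag.1 (hc ha)
    exact apply_mem_lev.2 (Fin.zero_le _)

theorem exists_lt_iff_of_antitone {N : ℕ} {P : Fin N → Prop} (hP : Antitone P) :
    ∃ p ≤ N, ∀ i : Fin N, P i ↔ (i : ℕ) < p := by
  by_cases h : ∃ i, ¬ P i
  · obtain ⟨m, hm, hmin⟩ := wellFounded_lt.has_min {i | ¬ P i} h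
    refine ⟨m, m.2.le, fun i => ⟨fun hi => ?_, fun hi => ?_⟩⟩
    · by_contra! hle
      exact hm (hP (Fin.le_def.2 hle) hi)
    · by_contra hi'
      exact hmin i hi' hi
  · push Not at h
    exact ⟨N, le_rfl, fun i => iff_of_true (h i) i.2⟩

theorem exists_monotone_enum {E κ : Type*} [Fintype E] [LinearOrder κ] (key : E → κ) :
    ∃ (N : ℕ) (ε : Fin N ≃ E), Monotone fun i => key (ε i) := by
  let ε₀ := (Fintype.equivFin E).symm
  exact ⟨_, (Tuple.sort (key ∘ ε₀)).trans ε₀, Tuple.monotone_sort (key ∘ ε₀)⟩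

theorem flagTiling_beginsWith (hσ : σ.card = M + 1) (hL : IsVertexOrder σ r L) {N : ℕ}
    {ε : Fin N ≃ (Fin (M + 1) ≃ σ)} (hε : Monotone fun i => enumKey r L (ε i))
    {T : RelCplx V} {α : Finset V} (hT : suppK T = α) (hασ : α ⊆ σ)
    (hα : ∀ a ∈ α, ∀ b ∈ σ, r b ≤ r a → b ∈ α) :
    (flagTiling (D := D) (μ := μ) hσ hL ε).BeginsWith
      (relDerivedNbhd T (faceTile σ D μ)) := by
  have hanti : Antitone fun i : Fin N => (ε i 0 : V) ∈ α := by
    intro i j hij hj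
    refine hα _ hj _ (ε i 0).2 ?_
    rcases Prod.Lex.le_iff.1 (hε hij) with h | h
    · exact h.le
    · exact h.1.le
  obtain ⟨p, hp, hiff⟩ := exists_lt_iff_of_antitone hanti
  refine ⟨p, hp, ?_⟩
  ext c
  rw [Tiling.mem_prefixFaces, mem_relDerivedNbhd hT hασ, ← Tiling.cover (flagTiling hσ hL ε),
    Finset.mem_biUnion]
  constructor
  · rintro ⟨i, hi, hc⟩
    exact ⟨⟨i, Finset.mem_univ i, hc⟩,
      (exists_forall_mem_iff_of_mem_flagTile hL hα hασ hc).2 ((hiff i).2 hi)⟩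
  · rintro ⟨⟨i, -, hc⟩, h⟩
    exact ⟨i, (hiff i).1 ((exists_forall_mem_iff_of_mem_flagTile hL hα hασ hc).1 h), hc⟩

theorem exists_isCriticalTile_faceTile_iff (hσ : σ.card = M + 1) (hDμ : D ⊆ μ) (hμ : μ ⊂ σ) :
    (∃ l, IsCriticalTile (faceTile σ D μ) M l) ↔ D = μ := by
  constructor
  · rintro ⟨l, h⟩
    obtain ⟨w, hw, hwμ⟩ := Finset.exists_of_ssubset hμ
    exact eq_of_isCriticalTile_faceTile (hDμ.trans hμ.1) hμ.1 hw (fun h' => hwμ (hDμ h')) hwμ h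
  · rintro rfl
    exact ⟨_, isCriticalTile_faceTile hσ hμ⟩

/-- The subdivision of `faceTile σ D μ` admits a Morse shelling beginning with the derived
neighborhood of a face `α` of `μ`. -/
theorem exists_morse_shelling_sdR_faceTile (hσ : σ.card = M + 1) (hDμ : D ⊆ μ) (hμ : μ ⊂ σ)
    {T : RelCplx V} {α : Finset V} (hT : suppK T = α) (hα : α ⊆ μ) :
    ∃ (N : ℕ) (Tl : Tiling (faceTile σ D μ).sdR N),
      Tl.IsMorse ∧ Tl.IsShelling ∧
      Tl.BeginsWith (relDerivedNbhd T (faceTile σ D μ)) ∧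
      ((∃ i : Fin N, ∃ m l, IsCriticalTile (Tl.tile i) m l) ↔
        ∃ l, IsCriticalTile (faceTile σ D μ) M l) ∧
      ∀ i : Fin N, (∃ m l, IsCriticalTile (Tl.tile i) m l) →
        ((∀ j : Fin N, (∃ m l, IsCriticalTile (Tl.tile j) m l) → j = i) ∧
          (∃ f : V → Finset V, IsRelIso f (faceTile σ D μ) (Tl.tile i)) ∧
          Disjoint (Tl.tile i).faces (relDerivedNbhd T (faceTile σ D μ))) := by
  have hασ := hα.trans hμ.1
  obtain ⟨r, L, hL, hrα, hne, heq⟩ := exists_vertexOrder hσ hDμ hμ hα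
  obtain ⟨N, ε, hε⟩ := exists_monotone_enum (enumKey (σ := σ) (M := M) r L)
  have hcrit : ∀ i, (∃ m l, IsCriticalTile ((flagTiling (D := D) (μ := μ) hσ hL ε).tile i) m l) ↔
      IsCritEnum D μ L (ε i) := fun i => exists_isCriticalTile_flagTile_iff hσ hDμ hμ (ε i)
  refine ⟨N, flagTiling hσ hL ε, flagTiling_isMorse hσ hL hDμ hμ ε,
    flagTiling_isShelling hσ hL hε, flagTiling_beginsWith hσ hL hε hT hασ hrα, ?_, ?_⟩
  · simp only [hcrit]
    rw [exists_isCriticalTile_faceTile_iff hσ hDμ hμ]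
    constructor
    · rintro ⟨i, hi⟩
      by_contra h
      exact hne h _ hi
    · intro h
      obtain ⟨e₀, he₀, -⟩ := heq h
      exact ⟨ε.symm e₀, by simpa using he₀⟩
  · simp only [hcrit]
    intro i hi
    have hD : D = μ := by
      by_contra h
      exact hne h _ hi
    obtain ⟨e₀, -, h0, hcard, huniq⟩ := heq hD
    have hie := huniq _ hi
    refine ⟨fun j hj => ε.injective ((huniq _ hj).trans hie.symm), ?_, ?_⟩
    · have hlow := (descSet_eq_lowSet_iff hσ hDμ hμ (ε i)).2 hi
      change ∃ f : V → Finset V, IsRelIso f _ (flagTile D μ L (ε i))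
      rw [flagTile, ← hlow, ← hD]
      refine exists_isRelIso_faceTile (hDμ.trans hμ.1) (descSet_subset_flag L _) ?_ ?_ ∅
      · rw [card_flag, hσ]
      · rw [hie, hcard]
    · refine Finset.disjoint_left.2 fun c hc hc' => ?_
      have := (exists_forall_mem_iff_of_mem_flagTile hL hrα hασ hc).1
        ((mem_relDerivedNbhd hT hασ).1 hc').2
      rw [hie] at this
      exact h0 this

end Subdivision

/-- **Theorem.** Let `T` be a nonempty basic tile and `T'` a non-basic Morse
tile, on disjoint vertex sets. Then `sd(T * T')` carries a Morse shelling which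
begins with `N(T, T * T')` and uses a critical tile iff `T * T'` is critical;
this critical tile is then unique, isomorphic to `T * T'` and disjoint from
`N(T, T * T')`. -/
theorem morse_shelling_of_sd_join_basic_nonbasic
    {V : Type*} [DecidableEq V] (T T' : RelCplx V) (n k n' k' : ℕ)
    (hT : IsBasicTile T n k) (hT' : IsMorseTile T' n' k')
    (hT'nb : ¬ ∃ m l, IsBasicTile T' m l)
    (hd : Disjoint (suppK T) (suppK T')) :
    ∃ (N : ℕ) (Tl : Tiling ((T.join T').sdR) N),
      Tl.IsMorse ∧ Tl.IsShelling ∧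
      Tl.BeginsWith (relDerivedNbhd T (T.join T')) ∧
      ((∃ i : Fin N, ∃ m l, IsCriticalTile (Tl.tile i) m l) ↔
        ∃ l, IsCriticalTile (T.join T') (n + n' + 1) l) ∧
      ∀ i : Fin N, (∃ m l, IsCriticalTile (Tl.tile i) m l) →
        ((∀ j : Fin N, (∃ m l, IsCriticalTile (Tl.tile j) m l) → j = i) ∧
          (∃ f : V → Finset V, IsRelIso f (T.join T') (Tl.tile i)) ∧
          Disjoint (Tl.tile i).faces (relDerivedNbhd T (T.join T'))) := by
  obtain ⟨α, A, hα, hA, hK, hL⟩ := exists_of_isBasicTile hT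
  obtain ⟨β, B, μ, hβ, hB, hμ, rfl⟩ := exists_of_isMorseTile hT' hT'nb
  have hsupp : suppK T = α := suppK_of_K_eq hK
  rw [hsupp, suppK_of_K_eq (α := β) rfl] at hd
  rw [join_eq_faceTile hA hK hL (hB.trans hμ.1) hd]
  refine exists_morse_shelling_sdR_faceTile ?_ (Finset.union_subset_union hA hB) ?_ hsupp
    Finset.subset_union_left
  · rw [Finset.card_union_of_disjoint hd, hα, hβ]
    omega
  · refine Finset.ssubset_iff_subset_ne.2 ⟨Finset.union_subset_union_right hμ.1, fun h => ?_⟩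
    obtain ⟨w, hw, hwμ⟩ := Finset.exists_of_ssubset hμ
    have hw' := h ▸ Finset.mem_union_right α hw
    rcases Finset.mem_union.1 hw' with h' | h'
    · exact Finset.disjoint_left.1 hd h' hw
    · exact hwμ h'

end MorseShelling
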